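/- arXiv:1407.3096 — 2 statements merged into one kernel-verified Lean document; each statement's English description precedes it below -/
import Mathlib

section
/- Assume (f_i)_{i=1}^N satisfies the open set condition and that ξ_{1,r} = ξ_{2,r}. Then the ξ_r-dimensional lower quantization coefficient of μ of order r is infinite: n^{1/ξ_r} e_{n,r}(μ) → ∞ as n → ∞ (in particular liminf_{n→∞} n^{1/ξ_r} e_{n,r}(μ) = ∞). -/
open MeasureTheory Filter

/-- The `n`-th quantization error of order `r` of a Borel measure `P` on `ℝ^q`:
the infimum of `(∫ d(x,α)^r dP)^{1/r}` over finite sets `α` with `1 ≤ card α ≤ n`. -/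
noncomputable def quantErr {q : ℕ} (P : Measure (EuclideanSpace ℝ (Fin q)))
    (n : ℕ) (r : ℝ) : ℝ :=
  sInf ((fun α : Finset (EuclideanSpace ℝ (Fin q)) =>
      (∫ x, Metric.infDist x (α : Set (EuclideanSpace ℝ (Fin q))) ^ r ∂P) ^ (1 / r)) ''
    {α : Finset (EuclideanSpace ℝ (Fin q)) | α.Nonempty ∧ α.card ≤ n})

/-- Product of weights `g` along a word `σ` (equals `1` for the empty word). -/
noncomputable def prodw {N : ℕ} (g : Fin N → ℝ) (σ : List (Fin N)) : ℝ := (σ.map g).prod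

/-- The composition `f_{σ_1} ∘ ⋯ ∘ f_{σ_n}` along a word `σ`. -/
def wordMap {q N : ℕ} (f : Fin N → EuclideanSpace ℝ (Fin q) → EuclideanSpace ℝ (Fin q))
    (σ : List (Fin N)) : EuclideanSpace ℝ (Fin q) → EuclideanSpace ℝ (Fin q) :=
  σ.foldr (fun i g => f i ∘ g) id

/-- `h(σ) = h^{(1)}(σ) + h^{(2)}(σ)` where
`h^{(1)}(σ) = Σ_{j=0}^{|σ|-1} p0 p_{σ|_j} t_{σ^{(l)}_{-j}} s_σ^r` and `h^{(2)}(σ) = p_σ s_σ^r`. -/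
noncomputable def hfun {N : ℕ} (r p0 : ℝ) (s t p : Fin N → ℝ) (σ : List (Fin N)) : ℝ :=
  (∑ j ∈ Finset.range σ.length, p0 * prodw p (σ.take j) * prodw t (σ.drop j)) * prodw s σ ^ r
    + prodw p σ * prodw s σ ^ r

/-- `η̲_r := min_{1 ≤ i ≤ N} min{p0 t_i + p_i, t_i} · s_i^r`. -/
noncomputable def etaLow {N : ℕ} (r p0 : ℝ) (s t p : Fin N → ℝ) : ℝ :=
  ⨅ i, min (p0 * t i + p i) (t i) * s i ^ r

/-- The finite maximal antichain `Λ_{k,r} = {σ : h(σ|_{|σ|-1}) ≥ η̲_r/k > h(σ)}`. -/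
def Lam {N : ℕ} (r p0 : ℝ) (s t p : Fin N → ℝ) (k : ℕ) : Set (List (Fin N)) :=
  {σ | σ ≠ [] ∧ etaLow r p0 s t p / k ≤ hfun r p0 s t p σ.dropLast ∧
    hfun r p0 s t p σ < etaLow r p0 s t p / k}

/-- `a(x) = Σ_i (t_i s_i^r)^{x/(x+r)}` (also used for `b` with `p` in place of `t`). -/
noncomputable def afun {N : ℕ} (r : ℝ) (s t : Fin N → ℝ) (x : ℝ) : ℝ :=
  ∑ i, (t i * s i ^ r) ^ (x / (x + r))

section Words

variable {q N : ℕ}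

@[simp] lemma prodw_nil (g : Fin N → ℝ) : prodw g [] = 1 := by simp [prodw]

@[simp] lemma prodw_cons (g : Fin N → ℝ) (i : Fin N) (σ : List (Fin N)) :
    prodw g (i :: σ) = g i * prodw g σ := by simp [prodw]

lemma prodw_append (g : Fin N → ℝ) (σ τ : List (Fin N)) :
    prodw g (σ ++ τ) = prodw g σ * prodw g τ := by simp [prodw]

lemma prodw_pos {g : Fin N → ℝ} (hg : ∀ i, 0 < g i) (σ : List (Fin N)) : 0 < prodw g σ := by
  induction σ with
  | nil => simp
  | cons i σ ih => simpa using mul_pos (hg i) ih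

lemma prodw_le_one {g : Fin N → ℝ} (hg : ∀ i, 0 < g i) (hg1 : ∀ i, g i ≤ 1)
    (σ : List (Fin N)) : prodw g σ ≤ 1 := by
  induction σ with
  | nil => simp
  | cons i σ ih => simpa using mul_le_one₀ (hg1 i) (prodw_pos hg σ).le ih

lemma prodw_le_pow {g : Fin N → ℝ} {b : ℝ} (hg : ∀ i, 0 < g i) (hb : ∀ i, g i ≤ b)
    (σ : List (Fin N)) : prodw g σ ≤ b ^ σ.length := by
  induction σ with
  | nil => simp
  | cons i σ ih =>
    rw [prodw_cons, List.length_cons, pow_succ']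
    exact mul_le_mul (hb i) ih (prodw_pos hg σ).le ((hg i).le.trans (hb i))

lemma prodw_le_of_prefix {g : Fin N → ℝ} (hg : ∀ i, 0 < g i) (hg1 : ∀ i, g i ≤ 1)
    {σ τ : List (Fin N)} (h : σ <+: τ) : prodw g τ ≤ prodw g σ := by
  obtain ⟨ρ, rfl⟩ := h
  rw [prodw_append]
  exact mul_le_of_le_one_right (prodw_pos hg σ).le (prodw_le_one hg hg1 ρ)

lemma prodw_mul_rpow {t s : Fin N → ℝ} (ht : ∀ i, 0 < t i) (hs : ∀ i, 0 < s i) (r θ : ℝ)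
    (σ : List (Fin N)) :
    prodw (fun i => (t i * s i ^ r) ^ θ) σ = (prodw t σ * prodw s σ ^ r) ^ θ := by
  induction σ with
  | nil => simp
  | cons i σ ih =>
    have h1 := prodw_pos ht σ
    have h2 := prodw_pos hs σ
    have h3 := ht i
    have h4 := hs i
    rw [prodw_cons, ih, prodw_cons, prodw_cons, Real.mul_rpow h4.le h2.le,
      ← Real.mul_rpow (by positivity) (by positivity)]
    congr 1
    ring

/-- A word of small weight has a prefix whose weight just drops below a given level. -/
lemma exists_prefix_prodw_lt {g : Fin N → ℝ} {a c : ℝ} (ha : ∀ i, a ≤ g i) (ha0 : 0 ≤ a)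
    (hc0 : 0 ≤ c) (hc : c ≤ 1) (w : List (Fin N)) (hw : prodw g w < c) :
    ∃ ρ, ρ <+: w ∧ a * c ≤ prodw g ρ ∧ prodw g ρ < c := by
  induction w using List.reverseRecOn with
  | nil => simp at hw; linarith
  | append_singleton v i ih =>
    by_cases h : prodw g v < c
    · obtain ⟨ρ, h1, h2⟩ := ih h
      exact ⟨ρ, h1.trans (List.prefix_append _ _), h2⟩
    · refine ⟨_, List.prefix_refl _, ?_, hw⟩
      rw [prodw_append, prodw_cons, prodw_nil, mul_one, mul_comm a]
      exact mul_le_mul (not_lt.1 h) (ha i) ha0 (hc0.trans (not_lt.1 h))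

@[simp] lemma wordMap_nil (f : Fin N → EuclideanSpace ℝ (Fin q) → EuclideanSpace ℝ (Fin q))
    (x : EuclideanSpace ℝ (Fin q)) : wordMap f [] x = x := rfl

@[simp] lemma wordMap_cons (f : Fin N → EuclideanSpace ℝ (Fin q) → EuclideanSpace ℝ (Fin q))
    (i : Fin N) (σ : List (Fin N)) (x : EuclideanSpace ℝ (Fin q)) :
    wordMap f (i :: σ) x = f i (wordMap f σ x) := rfl

lemma wordMap_append (f : Fin N → EuclideanSpace ℝ (Fin q) → EuclideanSpace ℝ (Fin q))
    (σ τ : List (Fin N)) (x : EuclideanSpace ℝ (Fin q)) :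
    wordMap f (σ ++ τ) x = wordMap f σ (wordMap f τ x) := by
  induction σ with
  | nil => rfl
  | cons i σ ih => simp [ih]

lemma wordMap_mem {f : Fin N → EuclideanSpace ℝ (Fin q) → EuclideanSpace ℝ (Fin q)}
    {A : Set (EuclideanSpace ℝ (Fin q))} (hA : ∀ i, f i '' A ⊆ A) (σ : List (Fin N))
    {x : EuclideanSpace ℝ (Fin q)} (hx : x ∈ A) : wordMap f σ x ∈ A := by
  induction σ with
  | nil => exact hx
  | cons i σ ih => exact hA i ⟨_, ih, rfl⟩

lemma dist_wordMap {f : Fin N → EuclideanSpace ℝ (Fin q) → EuclideanSpace ℝ (Fin q)}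
    {s : Fin N → ℝ} (hf : ∀ i x y, dist (f i x) (f i y) = s i * dist x y) (σ : List (Fin N))
    (x y : EuclideanSpace ℝ (Fin q)) :
    dist (wordMap f σ x) (wordMap f σ y) = prodw s σ * dist x y := by
  induction σ with
  | nil => simp
  | cons i σ ih => simp [hf, ih, mul_assoc]

/-- A similitude of a Euclidean space is onto. -/
lemma surjective_of_dist_eq_mul {g : EuclideanSpace ℝ (Fin q) → EuclideanSpace ℝ (Fin q)}
    {c : ℝ} (hc : 0 < c) (hg : ∀ x y, dist (g x) (g y) = c * dist x y) :
    Function.Surjective g := by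
  have hiso : Isometry fun x => c⁻¹ • g x := by
    refine Isometry.of_dist_eq fun x y => ?_
    rw [dist_smul₀, hg, Real.norm_of_nonneg (inv_nonneg.2 hc.le), ← mul_assoc,
      inv_mul_cancel₀ hc.ne', one_mul]
  let A := hiso.affineIsometryOfStrictConvexSpace
  have hA : Function.Surjective A := by
    have h1 : Function.Surjective A.linearIsometry.toLinearMap :=
      LinearMap.surjective_of_injective A.linearIsometry.injective
    exact (AffineMap.linear_surjective_iff A.toAffineMap).1 h1
  intro y
  obtain ⟨x, hx⟩ := hA (c⁻¹ • y)
  refine ⟨x, ?_⟩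
  have : c⁻¹ • g x = c⁻¹ • y := hx
  exact smul_right_injective _ (inv_ne_zero hc.ne') this

lemma surjective_wordMap {f : Fin N → EuclideanSpace ℝ (Fin q) → EuclideanSpace ℝ (Fin q)}
    {s : Fin N → ℝ} (hs : ∀ i, 0 < s i)
    (hf : ∀ i x y, dist (f i x) (f i y) = s i * dist x y) (σ : List (Fin N)) :
    Function.Surjective (wordMap f σ) :=
  surjective_of_dist_eq_mul (prodw_pos hs σ) (dist_wordMap hf σ)

end Words

section Separation

variable {q N : ℕ} {f : Fin N → EuclideanSpace ℝ (Fin q) → EuclideanSpace ℝ (Fin q)}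
  {s : Fin N → ℝ} {E U : Set (EuclideanSpace ℝ (Fin q))}

/-- Under the open set condition, incomparable words have disjoint images of the open set. -/
lemma wordMap_ne_of_incomparable (hs : ∀ i, 0 < s i)
    (hf : ∀ i x y, dist (f i x) (f i y) = s i * dist x y) (hU : ∀ i, f i '' U ⊆ U)
    (hUd : Pairwise fun i j => Disjoint (f i '' U) (f j '' U)) :
    ∀ σ τ : List (Fin N), ¬ σ <+: τ → ¬ τ <+: σ → ∀ x ∈ U, ∀ y ∈ U,
      wordMap f σ x ≠ wordMap f τ y := by
  intro σ
  induction σ with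
  | nil => intro τ h; exact absurd (List.nil_prefix) h
  | cons i σ ih =>
    intro τ h1 h2 x hx y hy hxy
    cases τ with
    | nil => exact h2 List.nil_prefix
    | cons j τ =>
      rcases eq_or_ne i j with rfl | hij
      · rw [List.cons_prefix_cons] at h1 h2
        refine ih τ (fun h => h1 ⟨rfl, h⟩) (fun h => h2 ⟨rfl, h⟩) x hx y hy ?_
        have := hf i (wordMap f σ x) (wordMap f τ y)
        rw [wordMap_cons, wordMap_cons] at hxy
        rw [hxy, dist_self] at this
        have h0 := (mul_eq_zero.1 this.symm).resolve_left (hs i).ne'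
        exact dist_eq_zero.1 h0
      · exact Set.disjoint_left.1 (hUd hij) ⟨_, wordMap_mem hU σ hx, rfl⟩
          ⟨_, wordMap_mem hU τ hy, hxy.symm⟩

/-- Boundedly many incomparable cells of size comparable to a given cell lie close to it. -/
lemma exists_card_neighbours_le {a : ℝ} (ha : 0 < a) (hs : ∀ i, 0 < s i)
    (hf : ∀ i x y, dist (f i x) (f i y) = s i * dist x y)
    (hE : Bornology.IsBounded E) (hU0 : U.Nonempty) (hUo : IsOpen U) (hU : ∀ i, f i '' U ⊆ U)
    (hUd : Pairwise fun i j => Disjoint (f i '' U) (f j '' U)) :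
    ∃ C : ℕ, ∀ (k : List (Fin N)) (J : Finset (List (Fin N))),
      IsAntichain (· <+: ·) (J : Set (List (Fin N))) →
      (∀ j ∈ J, a * prodw s k ≤ prodw s j ∧ prodw s j < prodw s k ∧
        ∃ x ∈ E, ∃ y ∈ E, dist (wordMap f k x) (wordMap f j y) < prodw s k) →
      J.card ≤ C := by
  obtain ⟨x₀, hx₀⟩ := hU0
  obtain ⟨ρ, hρ, hball⟩ := Metric.isOpen_iff.1 hUo x₀ hx₀
  obtain ⟨D, hD⟩ := hE.subset_closedBall x₀
  have hcpt : IsCompact (Metric.closedBall x₀ (D + 1 + D)) := isCompact_closedBall _ _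
  obtain ⟨T, -, hTf, hT⟩ := hcpt.finite_cover_balls (e := a * ρ / 2) (by positivity)
  refine ⟨hTf.toFinset.card, fun k J hJ hJk => ?_⟩
  have hk := prodw_pos hs k
  have hz : ∀ j : List (Fin N), ∃ z, wordMap f k z = wordMap f j x₀ :=
    fun j => surjective_wordMap hs hf k _
  choose z hz using hz
  have hzc : ∀ j ∈ J, ∃ c ∈ T, dist (z j) c < a * ρ / 2 := by
    intro j hj
    obtain ⟨-, h2, x, hx, y, hy, h3⟩ := hJk j hj
    have hx' := hD hx
    have hy' := hD hy
    rw [Metric.mem_closedBall] at hx' hy'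
    have h4 : dist (z j) x₀ ≤ D + 1 + D := by
      have h5 : prodw s k * dist (z j) x₀ ≤ prodw s k * (D + 1 + D) := by
        rw [← dist_wordMap hf, hz]
        calc dist (wordMap f j x₀) (wordMap f k x₀)
            ≤ dist (wordMap f j x₀) (wordMap f j y) + dist (wordMap f j y) (wordMap f k x)
              + dist (wordMap f k x) (wordMap f k x₀) := dist_triangle4 _ _ _ _
          _ ≤ prodw s k * D + prodw s k + prodw s k * D := by
            rw [dist_wordMap hf, dist_wordMap hf, dist_comm x₀ y,
              dist_comm (wordMap f j y)]
            gcongr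
          _ = _ := by ring
      exact le_of_mul_le_mul_left h5 hk
    have := hT (Metric.mem_closedBall.2 h4)
    simpa using this
  choose! c hcT hc using hzc
  refine Finset.card_le_card_of_injOn c (fun j hj => by simpa using hcT j hj) ?_
  intro j hj j' hj' hcc
  by_contra hne
  have h1 : dist (z j') (z j) < a * ρ := by
    have h1 := hc j hj
    have h2 := hc j' hj'
    rw [← hcc] at h2
    have := dist_triangle_right (z j') (z j) (c j)
    linarith
  have h2 : dist (wordMap f j' x₀) (wordMap f j x₀) < prodw s j * ρ := by
    rw [← hz, ← hz, dist_wordMap hf]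
    calc prodw s k * dist (z j') (z j) < prodw s k * (a * ρ) := by gcongr
      _ = a * prodw s k * ρ := by ring
      _ ≤ _ := by gcongr; exact (hJk j hj).1
  obtain ⟨x, hx⟩ := surjective_wordMap hs hf j (wordMap f j' x₀)
  have hxU : x ∈ U := by
    apply hball
    rw [← hx, dist_wordMap hf] at h2
    exact Metric.mem_ball.2 (lt_of_mul_lt_mul_left h2 (prodw_pos hs j).le)
  exact wordMap_ne_of_incomparable hs hf hU hUd j j' (hJ hj hj' hne)
    (hJ hj' hj (Ne.symm hne)) x hxU x₀ hx₀ hx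

lemma exists_wordMap_eq (hE : E = ⋃ i, f i '' E) (n : ℕ) {y : EuclideanSpace ℝ (Fin q)}
    (hy : y ∈ E) : ∃ v : List (Fin N), v.length = n ∧ ∃ z ∈ E, wordMap f v z = y := by
  induction n generalizing y with
  | zero => exact ⟨[], rfl, y, hy, rfl⟩
  | succ n ih =>
    rw [hE] at hy
    obtain ⟨i, y', hy', rfl⟩ := Set.mem_iUnion.1 hy
    obtain ⟨v, hv, z, hz, rfl⟩ := ih hy'
    exact ⟨i :: v, by simp [hv], z, hz, rfl⟩

/-- Schief's separation: some word `τ` has the property that every cell of the form `ω τ` stays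
away from all cells incomparable with `ω`, at a distance proportional to its size. -/
lemma exists_separating_word (hs : ∀ i, s i ∈ Set.Ioo (0 : ℝ) 1)
    (hf : ∀ i x y, dist (f i x) (f i y) = s i * dist x y)
    (hEb : Bornology.IsBounded E) (hE : E = ⋃ i, f i '' E)
    (hU0 : U.Nonempty) (hUo : IsOpen U) (hU : ∀ i, f i '' U ⊆ U)
    (hUd : Pairwise fun i j => Disjoint (f i '' U) (f j '' U)) (hN : 0 < N) :
    ∃ τ : List (Fin N), ∀ ω ω' : List (Fin N), ¬ ω <+: ω' → ¬ ω' <+: ω → ∀ x ∈ E, ∀ y ∈ E,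
      prodw s (ω ++ τ) ≤ dist (wordMap f (ω ++ τ) x) (wordMap f ω' y) := by
  classical
  have : Nonempty (Fin N) := ⟨⟨0, hN⟩⟩
  have hs0 : ∀ i, 0 < s i := fun i => (hs i).1
  have hs1 : ∀ i, s i ≤ 1 := fun i => (hs i).2.le
  have hEi : ∀ i, f i '' E ⊆ E := fun i x hx => by rw [hE]; exact Set.mem_iUnion.2 ⟨i, hx⟩
  obtain ⟨i₀, hi₀⟩ := Finite.exists_min s
  obtain ⟨i₁, hi₁⟩ := Finite.exists_max s
  obtain ⟨C, hC⟩ := exists_card_neighbours_le (hs0 i₀) hs0 hf hEb hU0 hUo hU hUd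
  let P : ℕ → Prop := fun n => ∃ (k : List (Fin N)) (J : Finset (List (Fin N))), J.card = n ∧
      IsAntichain (· <+: ·) (J : Set (List (Fin N))) ∧
      (∀ j ∈ J, s i₀ * prodw s k ≤ prodw s j ∧ prodw s j < prodw s k ∧
        ∃ x ∈ E, ∃ y ∈ E, dist (wordMap f k x) (wordMap f j y) < prodw s k)
  have hP0 : P 0 := ⟨[], ∅, rfl, by simp, by simp⟩
  have hPC : ∀ n, P n → n ≤ C := by
    rintro n ⟨k, J, rfl, h1, h2⟩
    exact hC k J h1 h2
  obtain ⟨τ, J, hJc, hJa, hJ⟩ : P (Nat.findGreatest P C) := Nat.findGreatest_spec (Nat.zero_le _) hP0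
  refine ⟨τ, fun ω ω' h1 h2 x hx y hy => ?_⟩
  by_contra! hlt
  have hpos := prodw_pos hs0 (ω ++ τ)
  obtain ⟨n, hn⟩ := exists_pow_lt_of_lt_one hpos (hs i₁).2
  obtain ⟨v, hv, z, hz, rfl⟩ := exists_wordMap_eq hE n hy
  have hw : prodw s (ω' ++ v) < prodw s (ω ++ τ) := by
    refine lt_of_le_of_lt ?_ hn
    rw [prodw_append, ← hv]
    exact (mul_le_of_le_one_left (prodw_pos hs0 v).le (prodw_le_one hs0 hs1 _)).trans
      (prodw_le_pow hs0 hi₁ v)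
  obtain ⟨ρ, ⟨v', hv'⟩, hρ1, hρ2⟩ := exists_prefix_prodw_lt hi₀ (hs0 i₀).le hpos.le
    (prodw_le_one hs0 hs1 _) _ hw
  have hωρ : ¬ ω <+: ρ := by
    intro h
    have h3 : ω <+: ω' ++ v := h.trans ⟨v', hv'⟩
    exact (List.prefix_or_prefix_of_prefix h3 (List.prefix_append _ _)).elim h1 h2
  have hρω : ¬ ρ <+: ω := fun h => by
    have h3 := prodw_le_of_prefix hs0 hs1 (h.trans (List.prefix_append ω τ))
    linarith
  have hP : P (J.card + 1) := by
    refine ⟨ω ++ τ, insert ρ (J.image (ω ++ ·)), ?_, ?_, ?_⟩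
    · rw [Finset.card_insert_of_notMem, Finset.card_image_of_injective _
        (List.append_right_injective ω)]
      intro h
      obtain ⟨j, -, rfl⟩ := Finset.mem_image.1 h
      exact hωρ (List.prefix_append _ _)
    · rw [Finset.coe_insert, Finset.coe_image]
      refine IsAntichain.insert ?_ ?_ ?_
      · rintro _ ⟨j, hj, rfl⟩ _ ⟨j', hj', rfl⟩ hne h
        exact hJa hj hj' (fun h => hne (by rw [h])) ((List.prefix_append_right_inj ω).1 h)
      · rintro _ ⟨j, hj, rfl⟩ - h
        exact hωρ ((List.prefix_append _ _).trans h)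
      · rintro _ ⟨j, hj, rfl⟩ - h
        exact (List.prefix_or_prefix_of_prefix h (List.prefix_append _ _)).elim hρω hωρ
    · intro j hj
      rcases Finset.mem_insert.1 hj with rfl | hj'
      · refine ⟨hρ1, hρ2, x, hx, wordMap f v' z, wordMap_mem hEi v' hz, ?_⟩
        rwa [← wordMap_append f j, hv', wordMap_append f ω']
      · obtain ⟨i, hi, rfl⟩ := Finset.mem_image.1 hj'
        obtain ⟨h3, h4, x', hx', y', hy', h5⟩ := hJ i hi
        have hω := prodw_pos hs0 ω
        refine ⟨?_, ?_, x', hx', y', hy', ?_⟩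
        · rw [prodw_append, prodw_append, mul_left_comm]; gcongr
        · rw [prodw_append, prodw_append]; gcongr
        · rw [prodw_append, wordMap_append, wordMap_append, dist_wordMap hf]; gcongr
  have h3 := Nat.le_findGreatest (hPC _ hP) hP
  omega

end Separation

section Trees

variable {q N : ℕ}

/-- The set of words whose first letter is some `i` and whose tail lies in `Λ i`. -/
def consUnion (Λ : Fin N → Finset (List (Fin N))) : Finset (List (Fin N)) :=
  Finset.univ.biUnion fun i => (Λ i).image (i :: ·)

lemma mem_consUnion {Λ : Fin N → Finset (List (Fin N))} {σ : List (Fin N)} :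
    σ ∈ consUnion Λ ↔ ∃ i, ∃ τ ∈ Λ i, i :: τ = σ := by
  simp [consUnion]

lemma sum_consUnion {M : Type*} [AddCommMonoid M] (Λ : Fin N → Finset (List (Fin N)))
    (g : List (Fin N) → M) :
    ∑ σ ∈ consUnion Λ, g σ = ∑ i, ∑ τ ∈ Λ i, g (i :: τ) := by
  rw [consUnion, Finset.sum_biUnion]
  · refine Finset.sum_congr rfl fun i _ => ?_
    rw [Finset.sum_image]
    intro a _ b _ h
    exact List.tail_eq_of_cons_eq h
  · intro i _ j _ hij
    rw [Function.onFun, Finset.disjoint_left]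
    intro σ h1 h2
    obtain ⟨a, -, rfl⟩ := Finset.mem_image.1 h1
    obtain ⟨b, -, h⟩ := Finset.mem_image.1 h2
    exact hij (List.head_eq_of_cons_eq h).symm

lemma isAntichain_consUnion {Λ : Fin N → Finset (List (Fin N))}
    (h : ∀ i, IsAntichain (· <+: ·) (Λ i : Set (List (Fin N)))) :
    IsAntichain (· <+: ·) (consUnion Λ : Set (List (Fin N))) := by
  intro σ hσ τ hτ hne hpre
  obtain ⟨i, a, ha, rfl⟩ := mem_consUnion.1 hσ
  obtain ⟨j, b, hb, rfl⟩ := mem_consUnion.1 hτ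
  obtain ⟨rfl, hab⟩ := List.cons_prefix_cons.1 hpre
  exact h i ha hb (fun e => hne (by rw [e])) hab

/-- A finite maximal antichain of words whose `u`-weights are all comparable with `ε`,
along which a self-similar measure decomposes. -/
lemma exists_antichain_prodw {f : Fin N → EuclideanSpace ℝ (Fin q) → EuclideanSpace ℝ (Fin q)}
    {u t : Fin N → ℝ} {a : ℝ} (hu : ∀ i, u i ∈ Set.Ioo (0 : ℝ) 1) (hu1 : ∑ i, u i = 1)
    (ha : ∀ i, a ≤ u i) (ht : ∀ i, 0 ≤ t i) (hfm : ∀ i, Measurable (f i))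
    {ν : Measure (EuclideanSpace ℝ (Fin q))}
    (hν : ∀ g : EuclideanSpace ℝ (Fin q) → ENNReal, Measurable g →
      ∫⁻ x, g x ∂ν = ∑ i, ENNReal.ofReal (t i) * ∫⁻ x, g (f i x) ∂ν)
    {ε : ℝ} (hε : 0 < ε) (hε1 : a * ε ≤ 1) :
    ∃ Λ : Finset (List (Fin N)), IsAntichain (· <+: ·) (Λ : Set (List (Fin N))) ∧
      (∀ ρ ∈ Λ, a * ε ≤ prodw u ρ ∧ prodw u ρ ≤ ε) ∧ ∑ ρ ∈ Λ, prodw u ρ = 1 ∧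
      ∀ g : EuclideanSpace ℝ (Fin q) → ENNReal, Measurable g →
        ∫⁻ x, g x ∂ν = ∑ ρ ∈ Λ, ENNReal.ofReal (prodw t ρ) * ∫⁻ x, g (wordMap f ρ x) ∂ν := by
  have hne : Nonempty (Fin N) := by
    by_contra h
    rw [not_nonempty_iff] at h
    simp at hu1
  obtain ⟨i₁, hi₁⟩ := Finite.exists_max u
  have key : ∀ L : ℕ, ∀ ε : ℝ, 0 < ε → a * ε ≤ 1 → u i₁ ^ L ≤ ε →
      ∃ Λ : Finset (List (Fin N)), IsAntichain (· <+: ·) (Λ : Set (List (Fin N))) ∧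
      (∀ ρ ∈ Λ, a * ε ≤ prodw u ρ ∧ prodw u ρ ≤ ε) ∧ ∑ ρ ∈ Λ, prodw u ρ = 1 ∧
      ∀ g : EuclideanSpace ℝ (Fin q) → ENNReal, Measurable g →
        ∫⁻ x, g x ∂ν = ∑ ρ ∈ Λ, ENNReal.ofReal (prodw t ρ) * ∫⁻ x, g (wordMap f ρ x) ∂ν := by
    intro L
    induction L with
    | zero =>
      intro ε _ h1 h2
      exact ⟨{[]}, by simp, by simpa using ⟨h1, by simpa using h2⟩, by simp, by simp⟩
    | succ L ih =>
      intro ε h0 h1 h2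
      by_cases hε : 1 ≤ ε
      · exact ⟨{[]}, by simp, by simpa using ⟨h1, by simpa using hε⟩, by simp, by simp⟩
      have hi : ∀ i, ∃ Λ : Finset (List (Fin N)),
          IsAntichain (· <+: ·) (Λ : Set (List (Fin N))) ∧
          (∀ ρ ∈ Λ, a * (ε / u i) ≤ prodw u ρ ∧ prodw u ρ ≤ ε / u i) ∧
          ∑ ρ ∈ Λ, prodw u ρ = 1 ∧
          ∀ g : EuclideanSpace ℝ (Fin q) → ENNReal, Measurable g →
            ∫⁻ x, g x ∂ν =
              ∑ ρ ∈ Λ, ENNReal.ofReal (prodw t ρ) * ∫⁻ x, g (wordMap f ρ x) ∂ν := by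
        intro i
        have hui := (hu i).1
        refine ih (ε / u i) (by positivity) ?_ ?_
        · rw [← mul_div_assoc, div_le_one hui]
          have := ha i
          nlinarith
        · rw [le_div_iff₀ hui]
          refine le_trans ?_ h2
          rw [pow_succ]
          exact mul_le_mul_of_nonneg_left (hi₁ i) (pow_nonneg (hu i₁).1.le _)
      choose Λ hΛ1 hΛ2 hΛ3 hΛ4 using hi
      refine ⟨consUnion Λ, isAntichain_consUnion hΛ1, ?_, ?_, ?_⟩
      · intro σ hσ
        obtain ⟨i, τ, hτ, rfl⟩ := mem_consUnion.1 hσ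
        have hui := (hu i).1
        obtain ⟨h3, h4⟩ := hΛ2 i τ hτ
        rw [prodw_cons]
        constructor
        · rwa [← mul_div_assoc, div_le_iff₀' hui] at h3
        · rwa [le_div_iff₀' hui] at h4
      · rw [sum_consUnion]
        simp only [prodw_cons, ← Finset.mul_sum, hΛ3, mul_one, hu1]
      · intro g hg
        rw [sum_consUnion, hν g hg]
        refine Finset.sum_congr rfl fun i _ => ?_
        rw [hΛ4 i (fun x => g (f i x)) (hg.comp (hfm i)), Finset.mul_sum]
        refine Finset.sum_congr rfl fun τ _ => ?_
        rw [prodw_cons, ENNReal.ofReal_mul (ht i), mul_assoc]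
        rfl
  obtain ⟨L, hL⟩ := exists_pow_lt_of_lt_one hε (hu i₁).2
  exact key L ε hε hε1 hL.le

/-- The words of length `m`. -/
def wordsOfLength (N : ℕ) : ℕ → Finset (List (Fin N))
  | 0 => {[]}
  | m + 1 => consUnion fun _ => wordsOfLength N m

lemma length_of_mem_wordsOfLength {m : ℕ} {σ : List (Fin N)} (h : σ ∈ wordsOfLength N m) :
    σ.length = m := by
  induction m generalizing σ with
  | zero => simpa [wordsOfLength] using h
  | succ m ih =>
    obtain ⟨i, τ, hτ, rfl⟩ := mem_consUnion.1 h
    simp [ih hτ]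

lemma sum_wordsOfLength_succ {M : Type*} [AddCommMonoid M] (m : ℕ) (g : List (Fin N) → M) :
    ∑ σ ∈ wordsOfLength N (m + 1), g σ = ∑ i, ∑ τ ∈ wordsOfLength N m, g (i :: τ) :=
  sum_consUnion _ _

/-- Product of `b` over the first `j` letters of a word and of `a` over the remaining ones. -/
def mixw (a b : Fin N → ℝ) : ℕ → List (Fin N) → ℝ
  | _, [] => 1
  | 0, i :: σ => a i * mixw a b 0 σ
  | j + 1, i :: σ => b i * mixw a b j σ

lemma mixw_pos {a b : Fin N → ℝ} (ha : ∀ i, 0 < a i) (hb : ∀ i, 0 < b i) (j : ℕ)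
    (σ : List (Fin N)) : 0 < mixw a b j σ := by
  induction σ generalizing j with
  | nil => cases j <;> simp [mixw]
  | cons i σ ih =>
    cases j with
    | zero => exact mul_pos (ha i) (ih 0)
    | succ j => exact mul_pos (hb i) (ih j)

lemma mixw_zero (a b : Fin N → ℝ) (σ : List (Fin N)) : mixw a b 0 σ = prodw a σ := by
  induction σ with
  | nil => simp [mixw]
  | cons i σ ih => simp [mixw, ih]

lemma mixw_mul_rpow {t p s : Fin N → ℝ} (ht : ∀ i, 0 < t i) (hp : ∀ i, 0 < p i)
    (hs : ∀ i, 0 < s i) (r θ : ℝ) (j : ℕ) (σ : List (Fin N)) :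
    mixw (fun i => (t i * s i ^ r) ^ θ) (fun i => (p i * s i ^ r) ^ θ) j σ =
      (mixw t p j σ * prodw s σ ^ r) ^ θ := by
  induction σ generalizing j with
  | nil => cases j <;> simp [mixw]
  | cons i σ ih =>
    have h2 := prodw_pos hs σ
    have h3 := ht i
    have h4 := hs i
    have h5 := hp i
    cases j with
    | zero =>
      have h1 := mixw_pos ht hp 0 σ
      rw [mixw, ih, mixw, prodw_cons, Real.mul_rpow h4.le h2.le,
        ← Real.mul_rpow (by positivity) (by positivity)]
      congr 1
      ring
    | succ j =>
      have h1 := mixw_pos ht hp j σ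
      rw [mixw, ih, mixw, prodw_cons, Real.mul_rpow h4.le h2.le,
        ← Real.mul_rpow (by positivity) (by positivity)]
      congr 1
      ring

lemma sum_mixw {a b : Fin N → ℝ} (ha1 : ∑ i, a i = 1) (hb1 : ∑ i, b i = 1) (m j : ℕ) :
    ∑ σ ∈ wordsOfLength N m, mixw a b j σ = 1 := by
  induction m generalizing j with
  | zero => cases j <;> simp [wordsOfLength, mixw]
  | succ m ih =>
    rw [sum_wordsOfLength_succ]
    cases j with
    | zero => simp [mixw, ← Finset.mul_sum, ih, ha1]
    | succ j => simp [mixw, ← Finset.mul_sum, ih, hb1]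

/-- The Bhattacharyya coefficient of two of the product weights `mixw`. -/
lemma sum_sqrt_mixw_mul {a b : Fin N → ℝ} (ha : ∀ i, 0 < a i) (hb : ∀ i, 0 < b i)
    (ha1 : ∑ i, a i = 1) (hb1 : ∑ i, b i = 1) (m j d : ℕ) (h : j + d ≤ m) :
    ∑ σ ∈ wordsOfLength N m, √(mixw a b j σ * mixw a b (j + d) σ) =
      (∑ i, √(a i * b i)) ^ d := by
  induction m generalizing j d with
  | zero =>
    obtain rfl : j = 0 := by omega
    obtain rfl : d = 0 := by omega
    simp [wordsOfLength, mixw]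
  | succ m ih =>
    rw [sum_wordsOfLength_succ]
    cases j with
    | zero =>
      cases d with
      | zero =>
        have h1 := sum_mixw ha1 hb1 (m + 1) 0
        rw [sum_wordsOfLength_succ] at h1
        simp only [add_zero, pow_zero, Real.sqrt_mul_self (mixw_pos ha hb _ _).le, h1]
      | succ d =>
        have h1 := ih 0 d (by omega)
        rw [zero_add] at h1 ⊢
        rw [pow_succ', ← h1, Finset.sum_mul]
        refine Finset.sum_congr rfl fun i _ => ?_
        rw [Finset.mul_sum]
        refine Finset.sum_congr rfl fun σ _ => ?_
        rw [mixw, mixw, mul_mul_mul_comm, Real.sqrt_mul (mul_pos (ha i) (hb i)).le]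
    | succ j =>
      have h1 := ih j d (by omega)
      rw [Nat.add_right_comm, ← h1]
      conv_rhs => rw [← one_mul (Finset.sum (wordsOfLength N m) _), ← hb1, Finset.sum_mul]
      refine Finset.sum_congr rfl fun i _ => ?_
      rw [Finset.mul_sum]
      refine Finset.sum_congr rfl fun σ _ => ?_
      rw [mixw, mixw, mul_mul_mul_comm, Real.sqrt_mul (mul_self_nonneg _),
        Real.sqrt_mul_self (hb i).le]

lemma sum_sqrt_mul_lt_one {a b : Fin N → ℝ} (ha : ∀ i, 0 < a i) (hb : ∀ i, 0 < b i)
    (ha1 : ∑ i, a i = 1) (hb1 : ∑ i, b i = 1) (hab : a ≠ b) : ∑ i, √(a i * b i) < 1 := by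
  obtain ⟨i₀, hi₀⟩ := Function.ne_iff.1 hab
  have h : ∑ i, √(a i * b i) < ∑ i, (a i + b i) / 2 := by
    have key : ∀ i, (a i + b i) / 2 - √(a i * b i) = (√(a i) - √(b i)) ^ 2 / 2 := fun i => by
      rw [Real.sqrt_mul (ha i).le, sub_sq, Real.sq_sqrt (ha i).le, Real.sq_sqrt (hb i).le]
      ring
    refine Finset.sum_lt_sum (fun i _ => ?_) ⟨i₀, Finset.mem_univ _, ?_⟩
    · have := key i
      nlinarith [sq_nonneg (√(a i) - √(b i))]
    · have h1 := key i₀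
      have h2 : √(a i₀) - √(b i₀) ≠ 0 := fun h =>
        hi₀ ((Real.sqrt_inj (ha i₀).le (hb i₀).le).1 (sub_eq_zero.1 h))
      have h3 : 0 < (√(a i₀) - √(b i₀)) ^ 2 := by positivity
      linarith
  rw [← Finset.sum_div, Finset.sum_add_distrib, ha1, hb1] at h
  linarith

lemma sum_le_add_sum_sqrt {ι : Type*} [DecidableEq ι] (S : Finset ι) (x : ι → ℝ)
    (hx : ∀ j ∈ S, 0 ≤ x j) {c : ℝ} (hc0 : 0 ≤ c) (hc : ∀ j ∈ S, x j ≤ c) :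
    ∑ j ∈ S, x j ≤ c + ∑ j ∈ S, ∑ k ∈ S.erase j, √(x j * x k) := by
  rcases S.eq_empty_or_nonempty with rfl | hS
  · simpa using hc0
  obtain ⟨k, hk, hmax⟩ := S.exists_max_image x hS
  rw [← Finset.add_sum_erase S x hk,
    ← Finset.add_sum_erase S (fun j => ∑ k ∈ S.erase j, √(x j * x k)) hk]
  have h1 : ∑ j ∈ S.erase k, x j ≤ ∑ j ∈ S.erase k, √(x k * x j) := by
    refine Finset.sum_le_sum fun j hj => ?_
    have hj' := Finset.mem_of_mem_erase hj
    refine Real.le_sqrt_of_sq_le ?_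
    rw [sq]
    exact mul_le_mul_of_nonneg_right (hmax j hj') (hx j hj')
  have h2 : 0 ≤ ∑ j ∈ S.erase k, ∑ k ∈ S.erase j, √(x j * x k) :=
    Finset.sum_nonneg fun _ _ => Finset.sum_nonneg fun _ _ => Real.sqrt_nonneg _
  linarith [hc k hk]

/-- A function dominating all the mutually almost singular weights `mixw a b j` has
large total mass on long words. -/
lemma exists_le_sum_of_mixw_le {a b : Fin N → ℝ} (ha : ∀ i, 0 < a i) (hb : ∀ i, 0 < b i)
    (ha1 : ∑ i, a i = 1) (hb1 : ∑ i, b i = 1) (hab : a ≠ b) (K : ℝ) :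
    ∃ m : ℕ, ∀ c : List (Fin N) → ℝ,
      (∀ σ ∈ wordsOfLength N m, ∀ j < m, mixw a b j σ ≤ c σ) →
      K ≤ ∑ σ ∈ wordsOfLength N m, c σ := by
  obtain ⟨n, hn⟩ := exists_nat_ge (2 * K)
  set β := ∑ i, √(a i * b i)
  have hβ0 : 0 ≤ β := Finset.sum_nonneg fun _ _ => Real.sqrt_nonneg _
  have hβ1 : β < 1 := sum_sqrt_mul_lt_one ha hb ha1 hb1 hab
  obtain ⟨L, hL⟩ := exists_pow_lt_of_lt_one (y := β) (x := 1 / (2 * (n + 1 : ℝ)))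
    (by positivity) hβ1
  refine ⟨(L + 1) * n + 1, fun c hc => ?_⟩
  set m := (L + 1) * n + 1
  have hlt : ∀ j ∈ Finset.range n, (L + 1) * j < m := fun j hj => by
    have := Nat.mul_le_mul_left (L + 1) (Finset.mem_range.1 hj).le
    omega
  have h1 : ∀ σ ∈ wordsOfLength N m, ∑ j ∈ Finset.range n, mixw a b ((L + 1) * j) σ ≤
      c σ + ∑ j ∈ Finset.range n, ∑ k ∈ (Finset.range n).erase j,
        √(mixw a b ((L + 1) * j) σ * mixw a b ((L + 1) * k) σ) := by
    intro σ hσ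
    refine sum_le_add_sum_sqrt _ (fun j => mixw a b ((L + 1) * j) σ)
      (fun j _ => (mixw_pos ha hb _ _).le)
      ((mixw_pos ha hb 0 σ).le.trans (hc σ hσ 0 (by omega))) fun j hj => hc σ hσ _ (hlt j hj)
  have h2 := Finset.sum_le_sum h1
  have hpair : ∀ j ∈ Finset.range n, ∀ k ∈ (Finset.range n).erase j,
      ∑ σ ∈ wordsOfLength N m, √(mixw a b ((L + 1) * j) σ * mixw a b ((L + 1) * k) σ) ≤
        1 / (2 * (n + 1 : ℝ)) := by
    have hord : ∀ j ∈ Finset.range n, ∀ k ∈ Finset.range n, j < k →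
        ∑ σ ∈ wordsOfLength N m, √(mixw a b ((L + 1) * j) σ * mixw a b ((L + 1) * k) σ) ≤
          1 / (2 * (n + 1 : ℝ)) := by
      intro j _ k hk hjk
      have h3 : (L + 1) * k = (L + 1) * j + (L + 1) * (k - j) := by
        rw [← mul_add]; congr 1; omega
      have h4 := hlt k hk
      rw [h3] at h4 ⊢
      rw [sum_sqrt_mixw_mul ha hb ha1 hb1 _ _ _ h4.le]
      refine le_trans (pow_le_pow_of_le_one hβ0 hβ1.le ?_) hL.le
      have : 1 ≤ k - j := by omega
      nlinarith
    intro j hj k hk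
    obtain ⟨hkj, hk⟩ := Finset.mem_erase.1 hk
    rcases lt_or_gt_of_ne hkj with h | h
    · simp_rw [mul_comm (mixw a b ((L + 1) * j) _)]
      exact hord k hk j hj h
    · exact hord j hj k hk h
  rw [Finset.sum_add_distrib, Finset.sum_comm] at h2
  simp only [sum_mixw ha1 hb1, Finset.sum_const, Finset.card_range, nsmul_eq_mul, mul_one] at h2
  have h5 : ∑ σ ∈ wordsOfLength N m, ∑ j ∈ Finset.range n, ∑ k ∈ (Finset.range n).erase j,
      √(mixw a b ((L + 1) * j) σ * mixw a b ((L + 1) * k) σ) ≤ n * (n * (1 / (2 * (n + 1 : ℝ)))) := by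
    rw [Finset.sum_comm]
    calc _ ≤ ∑ j ∈ Finset.range n, (n * (1 / (2 * (n + 1 : ℝ)))) := by
          refine Finset.sum_le_sum fun j hj => ?_
          rw [Finset.sum_comm]
          refine (Finset.sum_le_card_nsmul _ _ _ (hpair j hj)).trans ?_
          rw [nsmul_eq_mul]
          gcongr
          exact (Finset.card_erase_le).trans (by simp)
      _ = _ := by simp
  have h6 : (n : ℝ) * (n * (1 / (2 * (n + 1 : ℝ)))) ≤ n / 2 := by
    have : (n : ℝ) * (1 / (2 * (n + 1 : ℝ))) ≤ 1 / 2 := by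
      rw [mul_one_div, div_le_div_iff₀ (by positivity) (by norm_num)]
      linarith
    nlinarith [Nat.cast_nonneg (α := ℝ) n]
  linarith

end Trees

section Measures

variable {q N : ℕ} {f : Fin N → EuclideanSpace ℝ (Fin q) → EuclideanSpace ℝ (Fin q)}
  {s t p : Fin N → ℝ} {p0 : ℝ} {E : Set (EuclideanSpace ℝ (Fin q))}
  {μ ν : Measure (EuclideanSpace ℝ (Fin q))}

lemma measurable_wordMap (hfm : ∀ i, Measurable (f i)) (σ : List (Fin N)) :
    Measurable (wordMap f σ) := by
  induction σ with
  | nil => exact measurable_id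
  | cons i σ ih => exact (hfm i).comp ih

lemma ofReal_prodw_mul_lintegral_le (ht : ∀ i, 0 ≤ t i) (hfm : ∀ i, Measurable (f i))
    (hν : ∀ g : EuclideanSpace ℝ (Fin q) → ENNReal, Measurable g →
      ∫⁻ x, g x ∂ν = ∑ i, ENNReal.ofReal (t i) * ∫⁻ x, g (f i x) ∂ν)
    (τ : List (Fin N)) (g : EuclideanSpace ℝ (Fin q) → ENNReal) (hg : Measurable g) :
    ENNReal.ofReal (prodw t τ) * ∫⁻ x, g (wordMap f τ x) ∂ν ≤ ∫⁻ x, g x ∂ν := by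
  induction τ generalizing g with
  | nil => simp
  | cons i τ ih =>
    rw [prodw_cons, ENNReal.ofReal_mul (ht i), mul_assoc, hν g hg]
    refine le_trans ?_ (Finset.single_le_sum (fun _ _ => zero_le) (Finset.mem_univ i))
    gcongr
    exact ih (fun x => g (f i x)) (hg.comp (hfm i))

lemma lintegral_eq_sum_wordsOfLength (ht : ∀ i, 0 ≤ t i) (hfm : ∀ i, Measurable (f i))
    (hν : ∀ g : EuclideanSpace ℝ (Fin q) → ENNReal, Measurable g →
      ∫⁻ x, g x ∂ν = ∑ i, ENNReal.ofReal (t i) * ∫⁻ x, g (f i x) ∂ν)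
    (m : ℕ) (g : EuclideanSpace ℝ (Fin q) → ENNReal) (hg : Measurable g) :
    ∫⁻ x, g x ∂ν = ∑ σ ∈ wordsOfLength N m,
      ENNReal.ofReal (prodw t σ) * ∫⁻ x, g (wordMap f σ x) ∂ν := by
  induction m generalizing g with
  | zero => simp [wordsOfLength]
  | succ m ih =>
    rw [sum_wordsOfLength_succ, hν g hg]
    refine Finset.sum_congr rfl fun i _ => ?_
    rw [ih (fun x => g (f i x)) (hg.comp (hfm i)), Finset.mul_sum]
    refine Finset.sum_congr rfl fun τ _ => ?_
    rw [prodw_cons, ENNReal.ofReal_mul (ht i), mul_assoc]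
    rfl

/-- The weight with which the copy of `ν` in the cell of a word occurs in the in-homogeneous
measure `μ`. -/
noncomputable def cellMass (p0 : ℝ) (t p : Fin N → ℝ) : List (Fin N) → ℝ
  | [] => 0
  | i :: σ => p0 * prodw t (i :: σ) + p i * cellMass p0 t p σ

lemma cellMass_nonneg (hp0 : 0 < p0) (ht : ∀ i, 0 < t i) (hp : ∀ i, 0 < p i)
    (σ : List (Fin N)) : 0 ≤ cellMass p0 t p σ := by
  induction σ with
  | nil => exact le_rfl
  | cons i σ ih =>
    exact add_nonneg (mul_pos hp0 (prodw_pos ht _)).le (mul_nonneg (hp i).le ih)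

lemma mul_mixw_le_cellMass (hp0 : 0 < p0) (ht : ∀ i, 0 < t i) (hp : ∀ i, 0 < p i)
    {j : ℕ} {σ : List (Fin N)} (hj : j < σ.length) :
    p0 * mixw t p j σ ≤ cellMass p0 t p σ := by
  induction σ generalizing j with
  | nil => simp at hj
  | cons i σ ih =>
    cases j with
    | zero =>
      rw [mixw_zero, cellMass]
      linarith [mul_nonneg (hp i).le (cellMass_nonneg hp0 ht hp σ)]
    | succ j =>
      have h1 := mul_le_mul_of_nonneg_left (ih (j := j) (by simpa using hj)) (hp i).le
      have h2 := mul_pos hp0 (prodw_pos ht (i :: σ))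
      rw [mixw, cellMass]
      linarith

lemma cellMass_pos (hp0 : 0 < p0) (ht : ∀ i, 0 < t i) (hp : ∀ i, 0 < p i)
    {σ : List (Fin N)} (hσ : 0 < σ.length) : 0 < cellMass p0 t p σ :=
  (mul_pos hp0 (mixw_pos ht hp 0 σ)).trans_le (mul_mixw_le_cellMass hp0 ht hp hσ)

lemma sum_cellMass_mul_lintegral_le (hp0 : 0 < p0) (ht : ∀ i, 0 < t i) (hp : ∀ i, 0 < p i)
    (hfm : ∀ i, Measurable (f i))
    (hν : ∀ g : EuclideanSpace ℝ (Fin q) → ENNReal, Measurable g →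
      ∫⁻ x, g x ∂ν = ∑ i, ENNReal.ofReal (t i) * ∫⁻ x, g (f i x) ∂ν)
    (hμ : ∀ g : EuclideanSpace ℝ (Fin q) → ENNReal, Measurable g →
      ∫⁻ x, g x ∂μ = ENNReal.ofReal p0 * ∫⁻ x, g x ∂ν +
        ∑ i, ENNReal.ofReal (p i) * ∫⁻ x, g (f i x) ∂μ)
    (m : ℕ) (g : EuclideanSpace ℝ (Fin q) → ENNReal) (hg : Measurable g) :
    ∑ σ ∈ wordsOfLength N m, ENNReal.ofReal (cellMass p0 t p σ) * ∫⁻ x, g (wordMap f σ x) ∂ν ≤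
      ∫⁻ x, g x ∂μ := by
  induction m generalizing g with
  | zero => simp [wordsOfLength, cellMass]
  | succ m ih =>
    rw [hμ g hg, lintegral_eq_sum_wordsOfLength (fun i => (ht i).le) hfm hν (m + 1) g hg,
      sum_wordsOfLength_succ, sum_wordsOfLength_succ, Finset.mul_sum, ← Finset.sum_add_distrib]
    refine Finset.sum_le_sum fun i _ => ?_
    refine le_trans ?_ (add_le_add_right (mul_le_mul_right
      (ih (fun x => g (f i x)) (hg.comp (hfm i))) _) _)
    rw [Finset.mul_sum, Finset.mul_sum, ← Finset.sum_add_distrib]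
    refine Finset.sum_le_sum fun σ _ => ?_
    rw [cellMass, ENNReal.ofReal_add (mul_pos hp0 (prodw_pos ht _)).le
      (mul_nonneg (hp i).le (cellMass_nonneg hp0 ht hp σ)), ENNReal.ofReal_mul hp0.le,
      ENNReal.ofReal_mul (hp i).le, add_mul, mul_assoc, mul_assoc]
    rfl

/-- A compactly supported self-similar measure is carried by the self-similar set. -/
lemma ae_mem_of_selfSimilar [IsFiniteMeasure ν] (hs : ∀ i, s i ∈ Set.Ioo (0 : ℝ) 1)
    (hf : ∀ i x y, dist (f i x) (f i y) = s i * dist x y) (hEc : IsClosed E) (hE0 : E.Nonempty)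
    (hEi : ∀ i, f i '' E ⊆ E) (ht : ∀ i, 0 ≤ t i) (ht1 : ∑ i, t i = 1)
    (hνc : ∃ K, IsCompact K ∧ ν Kᶜ = 0)
    (hν : ∀ g : EuclideanSpace ℝ (Fin q) → ENNReal, Measurable g →
      ∫⁻ x, g x ∂ν = ∑ i, ENNReal.ofReal (t i) * ∫⁻ x, g (f i x) ∂ν) :
    ∀ᵐ x ∂ν, x ∈ E := by
  have hne : Nonempty (Fin N) := by
    by_contra h
    rw [not_nonempty_iff] at h
    simp at ht1
  obtain ⟨i₁, hi₁⟩ := Finite.exists_max s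
  obtain ⟨K, hK, hνK⟩ := hνc
  have hmeas : Measurable fun x => ENNReal.ofReal (Metric.infDist x E) := by fun_prop
  have hfin : ∫⁻ x, ENNReal.ofReal (Metric.infDist x E) ∂ν ≠ ⊤ := by
    obtain ⟨C, hC⟩ := (hK.image (Metric.continuous_infDist_pt E)).bddAbove
    have h1 : ∫⁻ x, ENNReal.ofReal (Metric.infDist x E) ∂ν ≤ ∫⁻ _, ENNReal.ofReal C ∂ν := by
      refine lintegral_mono_ae ?_
      have : ∀ᵐ x ∂ν, x ∈ K := hνK
      filter_upwards [this] with x hx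
      exact ENNReal.ofReal_le_ofReal (hC ⟨x, hx, rfl⟩)
    refine ne_top_of_le_ne_top ?_ h1
    rw [lintegral_const]
    exact ENNReal.mul_ne_top ENNReal.ofReal_ne_top (measure_ne_top _ _)
  have hcontr : ∀ i x, Metric.infDist (f i x) E ≤ s i₁ * Metric.infDist x E := by
    intro i x
    obtain ⟨y, hy, hxy⟩ := hEc.exists_infDist_eq_dist hE0 x
    rw [hxy]
    refine (Metric.infDist_le_dist_of_mem (hEi i ⟨y, hy, rfl⟩)).trans ?_
    rw [hf]
    exact mul_le_mul_of_nonneg_right (hi₁ i) dist_nonneg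
  have hle : ∫⁻ x, ENNReal.ofReal (Metric.infDist x E) ∂ν ≤
      ENNReal.ofReal (s i₁) * ∫⁻ x, ENNReal.ofReal (Metric.infDist x E) ∂ν := by
    calc _ = ∑ i, ENNReal.ofReal (t i) * ∫⁻ x, ENNReal.ofReal (Metric.infDist (f i x) E) ∂ν :=
          hν _ hmeas
      _ ≤ ∑ i, ENNReal.ofReal (t i) *
          (ENNReal.ofReal (s i₁) * ∫⁻ x, ENNReal.ofReal (Metric.infDist x E) ∂ν) := by
        gcongr with i
        rw [← lintegral_const_mul _ hmeas]
        refine lintegral_mono fun x => ?_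
        rw [← ENNReal.ofReal_mul (hs i₁).1.le]
        exact ENNReal.ofReal_le_ofReal (hcontr i x)
      _ = _ := by
        rw [← Finset.sum_mul, ← ENNReal.ofReal_sum_of_nonneg fun i _ => ht i, ht1,
          ENNReal.ofReal_one, one_mul]
  have hzero : ∫⁻ x, ENNReal.ofReal (Metric.infDist x E) ∂ν = 0 := by
    by_contra h0
    have h1 : ENNReal.ofReal (s i₁) < 1 := by
      rw [ENNReal.ofReal_lt_one]; exact (hs i₁).2
    have h2 := ENNReal.mul_lt_mul_left h0 hfin h1
    rw [one_mul] at h2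
    exact absurd (hle.trans_lt h2) (lt_irrefl _)
  rw [lintegral_eq_zero_iff hmeas] at hzero
  filter_upwards [hzero] with x hx
  rw [hEc.mem_iff_infDist_zero hE0]
  exact le_antisymm (ENNReal.ofReal_eq_zero.1 hx) Metric.infDist_nonneg

/-- Each codepoint is close to at most one of the separated cells, so a family of many cells
forces a large quantization error. -/
lemma ofReal_le_lintegral_infDist {ι : Type*} [IsProbabilityMeasure ν] {r : ℝ} (hr : 0 < r)
    (hs : ∀ i, 0 < s i) (hfm : ∀ i, Measurable (f i))
    (hEi : ∀ i, f i '' E ⊆ E) (hνE : ∀ᵐ x ∂ν, x ∈ E) (ht : ∀ i, 0 ≤ t i)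
    (hν : ∀ g : EuclideanSpace ℝ (Fin q) → ENNReal, Measurable g →
      ∫⁻ x, g x ∂ν = ∑ i, ENNReal.ofReal (t i) * ∫⁻ x, g (f i x) ∂ν)
    {τ : List (Fin N)} (hτ : ∀ ω ω' : List (Fin N), ¬ ω <+: ω' → ¬ ω' <+: ω →
      ∀ x ∈ E, ∀ y ∈ E,
        prodw s (ω ++ τ) ≤ dist (wordMap f (ω ++ τ) x) (wordMap f ω' y))
    (F : Finset ι) (w : ι → List (Fin N)) (W : ι → ℝ) {η : ℝ}
    (hw : ∀ i ∈ F, ∀ j ∈ F, i ≠ j → ¬ w i <+: w j) (hW0 : ∀ i ∈ F, 0 ≤ W i)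
    (hW : ∀ i ∈ F, η ≤ W i * prodw s (w i) ^ r)
    (hμ : ∀ g : EuclideanSpace ℝ (Fin q) → ENNReal, Measurable g →
      ∑ i ∈ F, ENNReal.ofReal (W i) * ∫⁻ x, g (wordMap f (w i) x) ∂ν ≤ ∫⁻ x, g x ∂μ)
    (n : ℕ) (hF : 2 * n ≤ F.card) (α : Finset (EuclideanSpace ℝ (Fin q))) (hα0 : α.Nonempty)
    (hα : α.card ≤ n) :
    ENNReal.ofReal (n * (prodw t τ * (prodw s τ / 2) ^ r * η)) ≤
      ∫⁻ x, ENNReal.ofReal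
        (Metric.infDist x (α : Set (EuclideanSpace ℝ (Fin q))) ^ r) ∂μ := by
  classical
  have htτ : 0 ≤ prodw t τ := List.prod_nonneg (by simpa using fun i _ => ht i)
  have hsτ := prodw_pos hs τ
  set g : EuclideanSpace ℝ (Fin q) → ENNReal := fun x =>
    ENNReal.ofReal (Metric.infDist x (α : Set (EuclideanSpace ℝ (Fin q))) ^ r) with hg
  have hgm : Measurable g := by fun_prop
  set far : ι → Prop := fun i => ∀ x ∈ E, ∀ a ∈ α,
    prodw s (w i ++ τ) / 2 ≤ dist (wordMap f (w i ++ τ) x) a with hfar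
  have hcard : (F.filter fun i => ¬ far i).card ≤ α.card := by
    have h1 : ∀ i ∈ F.filter fun i => ¬ far i, ∃ a ∈ α, ∃ x ∈ E,
        dist (wordMap f (w i ++ τ) x) a < prodw s (w i ++ τ) / 2 := by
      intro i hi
      have h2 := (Finset.mem_filter.1 hi).2
      simp only [hfar] at h2
      push Not at h2
      obtain ⟨x, hx, a, ha, h⟩ := h2
      exact ⟨a, ha, x, hx, h⟩
    choose! a haα x hxE hax using h1
    refine Finset.card_le_card_of_injOn a haα fun i hi j hj hij => ?_
    by_contra hne
    have h3 := hτ _ _ (hw i (Finset.mem_filter.1 hi).1 j (Finset.mem_filter.1 hj).1 hne)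
      (hw j (Finset.mem_filter.1 hj).1 i (Finset.mem_filter.1 hi).1 (Ne.symm hne))
    have h4 := hτ _ _ (hw j (Finset.mem_filter.1 hj).1 i (Finset.mem_filter.1 hi).1 (Ne.symm hne))
      (hw i (Finset.mem_filter.1 hi).1 j (Finset.mem_filter.1 hj).1 hne)
    have h3 := h3 _ (hxE i hi) _ (wordMap_mem hEi τ (hxE j hj))
    have h4 := h4 _ (hxE j hj) _ (wordMap_mem hEi τ (hxE i hi))
    rw [← wordMap_append] at h3 h4
    have h5 := hax i hi
    have h6 := hax j hj
    rw [← hij] at h6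
    have h7 := dist_triangle_right (wordMap f (w i ++ τ) (x i)) (wordMap f (w j ++ τ) (x j)) (a i)
    rw [dist_comm] at h4
    linarith
  have hcell : ∀ i ∈ F.filter far,
      ENNReal.ofReal (prodw t τ * (prodw s τ / 2) ^ r * η) ≤
        ENNReal.ofReal (W i) * ∫⁻ x, g (wordMap f (w i) x) ∂ν := by
    intro i hi
    obtain ⟨hiF, hi⟩ := Finset.mem_filter.1 hi
    have hsw := prodw_pos hs (w i)
    have h1 : ENNReal.ofReal ((prodw s (w i ++ τ) / 2) ^ r) ≤
        ∫⁻ x, g (wordMap f (w i) (wordMap f τ x)) ∂ν := by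
      calc _ = ∫⁻ _, ENNReal.ofReal ((prodw s (w i ++ τ) / 2) ^ r) ∂ν := by simp
        _ ≤ _ := by
          refine lintegral_mono_ae ?_
          filter_upwards [hνE] with x hx
          refine ENNReal.ofReal_le_ofReal (Real.rpow_le_rpow
            (div_nonneg (prodw_pos hs _).le zero_le_two) ?_ hr.le)
          rw [← wordMap_append]
          exact (Metric.le_infDist (by simpa using hα0)).2 fun {a} ha => hi x hx a ha
    have h2 := ofReal_prodw_mul_lintegral_le ht hfm hν τ (fun x => g (wordMap f (w i) x))
      (hgm.comp (measurable_wordMap hfm _))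
    refine le_trans ?_ (mul_le_mul_right ((mul_le_mul_right h1 _).trans h2) _)
    rw [← ENNReal.ofReal_mul htτ, ← ENNReal.ofReal_mul (hW0 i hiF)]
    refine ENNReal.ofReal_le_ofReal ?_
    rw [prodw_append, mul_div_assoc, Real.mul_rpow hsw.le (by positivity)]
    calc _ ≤ prodw t τ * (prodw s τ / 2) ^ r * (W i * prodw s (w i) ^ r) :=
          mul_le_mul_of_nonneg_left (hW i hiF) (by positivity)
      _ = _ := by ring
  have hn : n ≤ (F.filter far).card := by
    have := F.card_filter_add_card_filter_not far
    omega
  calc _ = (n : ENNReal) * ENNReal.ofReal (prodw t τ * (prodw s τ / 2) ^ r * η) := by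
        rw [ENNReal.ofReal_mul (Nat.cast_nonneg n), ENNReal.ofReal_natCast]
    _ ≤ ((F.filter far).card : ENNReal) *
        ENNReal.ofReal (prodw t τ * (prodw s τ / 2) ^ r * η) := by gcongr
    _ ≤ ∑ i ∈ F.filter far, ENNReal.ofReal (W i) * ∫⁻ x, g (wordMap f (w i) x) ∂ν := by
        rw [← nsmul_eq_mul]
        exact Finset.card_nsmul_le_sum _ _ _ hcell
    _ ≤ ∑ i ∈ F, ENNReal.ofReal (W i) * ∫⁻ x, g (wordMap f (w i) x) ∂ν :=
        Finset.sum_le_sum_of_subset (Finset.filter_subset _ _)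
    _ ≤ _ := hμ g hgm

/-- For every `K` and all small `ε`, the measure `μ` dominates a sum of copies of `ν` over
an antichain of at least `K / ε` words with weights comparable with `ε`. -/
lemma exists_cells {r θ : ℝ} {a : ℝ} (hθ : 0 < θ) (hr : 0 < r)
    (hs : ∀ i, s i ∈ Set.Ioo (0 : ℝ) 1)
    (hp0 : 0 < p0) (ht : ∀ i, 0 < t i) (hp : ∀ i, 0 < p i) (ht1 : ∑ i, t i = 1)
    (hp1 : p0 + ∑ i, p i = 1) (hfm : ∀ i, Measurable (f i))
    (hν : ∀ g : EuclideanSpace ℝ (Fin q) → ENNReal, Measurable g →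
      ∫⁻ x, g x ∂ν = ∑ i, ENNReal.ofReal (t i) * ∫⁻ x, g (f i x) ∂ν)
    (hμ : ∀ g : EuclideanSpace ℝ (Fin q) → ENNReal, Measurable g →
      ∫⁻ x, g x ∂μ = ENNReal.ofReal p0 * ∫⁻ x, g x ∂ν +
        ∑ i, ENNReal.ofReal (p i) * ∫⁻ x, g (f i x) ∂μ)
    (htθ : ∑ i, (t i * s i ^ r) ^ θ = 1) (hpθ : ∑ i, (p i * s i ^ r) ^ θ = 1)
    (ha : ∀ i, a ≤ (t i * s i ^ r) ^ θ) (ha0 : 0 < a) (ha1 : a ≤ 1) {K : ℝ} (hK : 0 < K) :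
    ∃ ε₀ > 0, ∀ ε, 0 < ε → ε ≤ ε₀ →
      ∃ (F : Finset (Σ _ : List (Fin N), List (Fin N)))
        (W : (Σ _ : List (Fin N), List (Fin N)) → ℝ),
        (∀ i ∈ F, ∀ j ∈ F, i ≠ j → ¬ (i.1 ++ i.2) <+: (j.1 ++ j.2)) ∧ (∀ i ∈ F, 0 ≤ W i) ∧
        (∀ i ∈ F, (a * ε) ^ (1 / θ) ≤ W i * prodw s (i.1 ++ i.2) ^ r) ∧
        (∀ g : EuclideanSpace ℝ (Fin q) → ENNReal, Measurable g →
          ∑ i ∈ F, ENNReal.ofReal (W i) * ∫⁻ x, g (wordMap f (i.1 ++ i.2) x) ∂ν ≤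
            ∫⁻ x, g x ∂μ) ∧
        K ≤ F.card * ε := by
  have hs0 : ∀ i, 0 < s i := fun i => (hs i).1
  have hA : ∀ i, 0 < (t i * s i ^ r) ^ θ := fun i =>
    Real.rpow_pos_of_pos (mul_pos (ht i) (Real.rpow_pos_of_pos (hs0 i) r)) θ
  have hB : ∀ i, 0 < (p i * s i ^ r) ^ θ := fun i =>
    Real.rpow_pos_of_pos (mul_pos (hp i) (Real.rpow_pos_of_pos (hs0 i) r)) θ
  have hA1 : ∀ i, (t i * s i ^ r) ^ θ < 1 := fun i => by
    have h1 : t i ≤ 1 := ht1 ▸ Finset.single_le_sum (fun j _ => (ht j).le) (Finset.mem_univ i)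
    have h2 : s i ^ r < 1 := Real.rpow_lt_one (hs0 i).le (hs i).2 hr
    have h3 := Real.rpow_pos_of_pos (hs0 i) r
    refine Real.rpow_lt_one (mul_pos (ht i) h3).le ?_ hθ
    nlinarith [ht i]
  have hAB : (fun i => (t i * s i ^ r) ^ θ) ≠ fun i => (p i * s i ^ r) ^ θ := by
    intro h
    have htp : ∀ i, t i = p i := fun i => by
      have h1 := Real.rpow_pos_of_pos (hs0 i) r
      have h2 := Real.rpow_left_injOn hθ.ne' (mul_pos (ht i) h1).le (mul_pos (hp i) h1).le
        (congrFun h i)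
      exact mul_right_cancel₀ h1.ne' h2
    rw [← Finset.sum_congr rfl fun i _ => htp i, ht1] at hp1
    linarith
  have hp0θ := Real.rpow_pos_of_pos hp0 θ
  obtain ⟨m, hm⟩ := exists_le_sum_of_mixw_le hA hB htθ hpθ hAB (K / p0 ^ θ)
  set C : List (Fin N) → ℝ := fun σ => (cellMass p0 t p σ * prodw s σ ^ r) ^ θ with hC
  have hsr : ∀ σ : List (Fin N), 0 < prodw s σ ^ r := fun σ =>
    Real.rpow_pos_of_pos (prodw_pos hs0 σ) r
  have hsum : K ≤ ∑ σ ∈ wordsOfLength N m, C σ := by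
    have h1 := hm (fun σ => C σ / p0 ^ θ) fun σ hσ j hj => by
      rw [mixw_mul_rpow ht hp hs0, le_div_iff₀' hp0θ,
        ← Real.mul_rpow hp0.le (mul_pos (mixw_pos ht hp j σ) (hsr σ)).le, ← mul_assoc]
      have h2 := mixw_pos ht hp j σ
      refine Real.rpow_le_rpow (mul_pos (mul_pos hp0 h2) (hsr σ)).le ?_ hθ.le
      exact mul_le_mul_of_nonneg_right (mul_mixw_le_cellMass hp0 ht hp
        (by rwa [length_of_mem_wordsOfLength hσ])) (hsr σ).le
    rw [← Finset.sum_div] at h1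
    exact (div_le_div_iff_of_pos_right hp0θ).1 h1
  have hm0 : 0 < m := by
    rcases Nat.eq_zero_or_pos m with rfl | h
    · simp [wordsOfLength, hC, cellMass, Real.zero_rpow hθ.ne'] at hsum
      linarith
    · exact h
  have hcm : ∀ σ ∈ wordsOfLength N m, 0 < cellMass p0 t p σ := fun σ hσ =>
    cellMass_pos hp0 ht hp (by rwa [length_of_mem_wordsOfLength hσ])
  have hCpos : ∀ σ ∈ wordsOfLength N m, 0 < C σ := fun σ hσ =>
    Real.rpow_pos_of_pos (mul_pos (hcm σ hσ) (hsr σ)) θ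
  have hwne : (wordsOfLength N m).Nonempty := by
    by_contra h
    rw [Finset.not_nonempty_iff_eq_empty] at h
    rw [h, Finset.sum_empty] at hsum
    linarith
  obtain ⟨σ₀, hσ₀, hmin⟩ := Finset.exists_min_image _ C hwne
  refine ⟨C σ₀, hCpos σ₀ hσ₀, fun ε hε hεC => ?_⟩
  have hΛ : ∀ σ, ∃ Λ : Finset (List (Fin N)), σ ∈ wordsOfLength N m →
      IsAntichain (· <+: ·) (Λ : Set (List (Fin N))) ∧
      (∀ ρ ∈ Λ, a * ε ≤ C σ * prodw (fun i => (t i * s i ^ r) ^ θ) ρ ∧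
        C σ * prodw (fun i => (t i * s i ^ r) ^ θ) ρ ≤ ε) ∧
      ∑ ρ ∈ Λ, prodw (fun i => (t i * s i ^ r) ^ θ) ρ = 1 ∧
      ∀ g : EuclideanSpace ℝ (Fin q) → ENNReal, Measurable g →
        ∫⁻ x, g x ∂ν = ∑ ρ ∈ Λ, ENNReal.ofReal (prodw t ρ) * ∫⁻ x, g (wordMap f ρ x) ∂ν := by
    intro σ
    by_cases hσ : σ ∈ wordsOfLength N m
    · have hc := hCpos σ hσ
      have h1 : a * (ε / C σ) ≤ 1 := by
        have h2 : ε / C σ ≤ 1 := (div_le_one hc).2 (hεC.trans (hmin σ hσ))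
        exact mul_le_one₀ ha1 (by positivity) h2
      obtain ⟨Λ, h2, h3, h4⟩ := exists_antichain_prodw (fun i => ⟨hA i, hA1 i⟩) htθ ha
        (fun i => (ht i).le) hfm hν (div_pos hε hc) h1
      refine ⟨Λ, fun _ => ⟨h2, fun ρ hρ => ?_, h4⟩⟩
      obtain ⟨h5, h6⟩ := h3 ρ hρ
      rw [← mul_div_assoc, div_le_iff₀' hc] at h5
      rw [le_div_iff₀' hc] at h6
      exact ⟨h5, h6⟩
    · exact ⟨∅, fun h => absurd h hσ⟩
  choose Λ hΛ using hΛ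
  refine ⟨(wordsOfLength N m).sigma Λ, fun i => cellMass p0 t p i.1 * prodw t i.2,
    ?_, ?_, ?_, ?_, ?_⟩
  · rintro ⟨σ, ρ⟩ hi ⟨σ', ρ'⟩ hj hne hpre
    obtain ⟨hσ, hρ⟩ := Finset.mem_sigma.1 hi
    obtain ⟨hσ', hρ'⟩ := Finset.mem_sigma.1 hj
    have hlen : σ.length = σ'.length := by
      rw [length_of_mem_wordsOfLength hσ, length_of_mem_wordsOfLength hσ']
    have h1 : σ = σ' := (List.prefix_of_prefix_length_le ((List.prefix_append σ ρ).trans hpre)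
      (List.prefix_append σ' ρ') hlen.le).eq_of_length hlen
    subst h1
    exact (hΛ σ hσ).1 hρ hρ' (fun h => hne (Sigma.ext rfl (heq_of_eq h)))
      ((List.prefix_append_right_inj σ).1 hpre)
  · rintro ⟨σ, ρ⟩ -
    exact mul_nonneg (cellMass_nonneg hp0 ht hp σ) (prodw_pos ht ρ).le
  · rintro ⟨σ, ρ⟩ hi
    obtain ⟨hσ, hρ⟩ := Finset.mem_sigma.1 hi
    have h1 := ((hΛ σ hσ).2.1 ρ hρ).1
    have h2 := mul_pos (hcm σ hσ) (hsr σ)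
    have h3 := mul_pos (prodw_pos ht ρ) (hsr ρ)
    rw [prodw_mul_rpow ht hs0, ← Real.mul_rpow h2.le h3.le] at h1
    have h4 := Real.rpow_le_rpow (mul_pos ha0 hε).le h1 (one_div_pos.2 hθ).le
    rw [← Real.rpow_mul (mul_pos h2 h3).le, mul_one_div_cancel hθ.ne', Real.rpow_one] at h4
    refine h4.trans_eq ?_
    rw [prodw_append, Real.mul_rpow (prodw_pos hs0 σ).le (prodw_pos hs0 ρ).le]
    ring
  · intro g hg
    refine le_trans (le_of_eq ?_) (sum_cellMass_mul_lintegral_le hp0 ht hp hfm hν hμ m g hg)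
    rw [Finset.sum_sigma]
    refine Finset.sum_congr rfl fun σ hσ => ?_
    rw [(hΛ σ hσ).2.2.2 (fun x => g (wordMap f σ x)) (hg.comp (measurable_wordMap hfm σ)),
      Finset.mul_sum]
    refine Finset.sum_congr rfl fun ρ _ => ?_
    simp only [wordMap_append]
    rw [ENNReal.ofReal_mul (cellMass_nonneg hp0 ht hp σ), mul_assoc]
  · calc K ≤ ∑ σ ∈ wordsOfLength N m, C σ := hsum
      _ = ∑ i ∈ (wordsOfLength N m).sigma Λ,
          C i.1 * prodw (fun i => (t i * s i ^ r) ^ θ) i.2 := by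
        rw [Finset.sum_sigma]
        refine Finset.sum_congr rfl fun σ hσ => ?_
        exact (by rw [← Finset.mul_sum, (hΛ σ hσ).2.2.1, mul_one] :
          C σ = ∑ ρ ∈ Λ σ, C σ * prodw (fun i => (t i * s i ^ r) ^ θ) ρ)
      _ ≤ ((wordsOfLength N m).sigma Λ).card • ε := by
        refine Finset.sum_le_card_nsmul _ _ _ ?_
        rintro ⟨σ, ρ⟩ hi
        obtain ⟨hσ, hρ⟩ := Finset.mem_sigma.1 hi
        exact ((hΛ σ hσ).2.1 ρ hρ).2
      _ = _ := nsmul_eq_mul _ _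

end Measures

/-- Theorem (Zhu): under the OSC, if `ξ_{1,r} = ξ_{2,r}` then the `ξ_r`-dimensional lower
quantization coefficient of `μ` of order `r` is infinite: `n^{1/ξ_r} e_{n,r}(μ) → ∞`. -/
theorem lower_quantization_coefficient_infinite_of_eq
    (q N : ℕ) (hq : 1 ≤ q) (hN : 2 ≤ N) (r : ℝ) (hr : 0 < r)
    (f : Fin N → EuclideanSpace ℝ (Fin q) → EuclideanSpace ℝ (Fin q))
    (s : Fin N → ℝ) (hs : ∀ i, s i ∈ Set.Ioo (0 : ℝ) 1)
    (hf : ∀ i x y, dist (f i x) (f i y) = s i * dist x y)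
    (E : Set (EuclideanSpace ℝ (Fin q)))
    (hEcpt : IsCompact E) (hEne : E.Nonempty) (hEss : E = ⋃ i, f i '' E)
    (hEdiam : Metric.diam E = 1)
    (hOSC : ∃ U : Set (EuclideanSpace ℝ (Fin q)), U.Nonempty ∧ IsOpen U ∧
      (∀ i, f i '' U ⊆ U) ∧ Pairwise fun i j => Disjoint (f i '' U) (f j '' U))
    (t : Fin N → ℝ) (ht : ∀ i, 0 < t i) (ht1 : ∑ i, t i = 1)
    (ν : Measure (EuclideanSpace ℝ (Fin q))) (hνP : IsProbabilityMeasure ν)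
    (hνc : ∃ K, IsCompact K ∧ ν Kᶜ = 0)
    (hνss : ν = ∑ i, ENNReal.ofReal (t i) • ν.map (f i))
    (p0 : ℝ) (p : Fin N → ℝ) (hp0 : 0 < p0) (hp : ∀ i, 0 < p i)
    (hp1 : p0 + ∑ i, p i = 1)
    (μ : Measure (EuclideanSpace ℝ (Fin q))) (hμP : IsProbabilityMeasure μ)
    (hμc : ∃ K, IsCompact K ∧ μ Kᶜ = 0)
    (hμss : μ = ENNReal.ofReal p0 • ν + ∑ i, ENNReal.ofReal (p i) • μ.map (f i))
    (ξ1 ξ2 : ℝ) (hξ1 : 0 < ξ1) (hξ2 : 0 < ξ2)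
    (hξ1e : ∑ i, (t i * s i ^ r) ^ (ξ1 / (ξ1 + r)) = 1)
    (hξ2e : ∑ i, (p i * s i ^ r) ^ (ξ2 / (ξ2 + r)) = 1)
    (heq : ξ1 = ξ2) :
    Tendsto (fun n : ℕ => (n : ℝ) ^ (1 / max ξ1 ξ2) * quantErr μ n r) atTop atTop := by
  subst heq
  rw [max_self]
  classical
  obtain ⟨U, hU0, hUo, hUi, hUd⟩ := hOSC
  have hN0 : 0 < N := by omega
  have : Nonempty (Fin N) := ⟨⟨0, hN0⟩⟩
  have hs0 : ∀ i, 0 < s i := fun i => (hs i).1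
  have hEi : ∀ i, f i '' E ⊆ E := fun i x hx => by
    rw [hEss]
    exact Set.mem_iUnion.2 ⟨i, hx⟩
  have hfm : ∀ i, Measurable (f i) := fun i => by
    have : LipschitzWith (s i).toNNReal (f i) := LipschitzWith.of_dist_le_mul fun x y => by
      rw [hf, Real.coe_toNNReal _ (hs0 i).le]
    exact this.continuous.measurable
  have hν : ∀ g : EuclideanSpace ℝ (Fin q) → ENNReal, Measurable g →
      ∫⁻ x, g x ∂ν = ∑ i, ENNReal.ofReal (t i) * ∫⁻ x, g (f i x) ∂ν := fun g hg => by
    conv_lhs => rw [hνss]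
    simp_rw [lintegral_finsetSum_measure, lintegral_smul_measure, lintegral_map hg (hfm _),
      smul_eq_mul]
  have hμ : ∀ g : EuclideanSpace ℝ (Fin q) → ENNReal, Measurable g →
      ∫⁻ x, g x ∂μ = ENNReal.ofReal p0 * ∫⁻ x, g x ∂ν +
        ∑ i, ENNReal.ofReal (p i) * ∫⁻ x, g (f i x) ∂μ := fun g hg => by
    conv_lhs => rw [hμss]
    simp_rw [lintegral_add_measure, lintegral_finsetSum_measure, lintegral_smul_measure,
      lintegral_map hg (hfm _), smul_eq_mul]
  have hνE : ∀ᵐ x ∂ν, x ∈ E := ae_mem_of_selfSimilar hs hf hEcpt.isClosed hEne hEi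
    (fun i => (ht i).le) ht1 hνc hν
  obtain ⟨τ, hτ⟩ := exists_separating_word hs hf hEcpt.isBounded hEss hU0 hUo hUi hUd hN0
  set θ := ξ1 / (ξ1 + r) with hθdef
  have hθ : 0 < θ := by positivity
  have hθinv : 1 / θ = 1 + r / ξ1 := by
    rw [hθdef]
    field_simp
  obtain ⟨i₀, hi₀⟩ := Finite.exists_min fun i => (t i * s i ^ r) ^ θ
  set a := (t i₀ * s i₀ ^ r) ^ θ with ha
  have hapos : ∀ i, 0 < (t i * s i ^ r) ^ θ := fun i =>
    Real.rpow_pos_of_pos (mul_pos (ht i) (Real.rpow_pos_of_pos (hs0 i) r)) θ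
  have ha0 : 0 < a := hapos i₀
  have ha1 : a ≤ 1 :=
    hξ1e ▸ Finset.single_le_sum (fun j _ => (hapos j).le) (Finset.mem_univ i₀)
  set κ := prodw t τ * (prodw s τ / 2) ^ r with hκdef
  have hκ : 0 < κ := mul_pos (prodw_pos ht τ)
    (Real.rpow_pos_of_pos (half_pos (prodw_pos hs0 τ)) r)
  obtain ⟨Kμ, hKμ, hμK⟩ := hμc
  rw [tendsto_atTop]
  intro B
  obtain ⟨b, hb, hB⟩ : ∃ b : ℝ, 0 < b ∧ B ≤ b := ⟨max B 1, by positivity, le_max_left _ _⟩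
  set K : ℝ := 2 / a * (b ^ r / κ) ^ θ with hKdef
  have hK : 0 < K := by positivity
  have hKb : κ * (a * (K / 2)) ^ (1 / θ) = b ^ r := by
    have h1 : a * (K / 2) = (b ^ r / κ) ^ θ := by
      rw [hKdef]
      field_simp
    rw [h1, ← Real.rpow_mul (by positivity), mul_one_div_cancel hθ.ne', Real.rpow_one]
    field_simp
  obtain ⟨ε₀, hε₀, hcells⟩ := exists_cells hθ hr hs hp0 ht hp ht1 hp1 hfm hν hμ hξ1e hξ2e
    hi₀ ha0 ha1 hK
  filter_upwards [eventually_ge_atTop 1, eventually_ge_atTop ⌈K / 2 / ε₀⌉₊] with n hn1 hn2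
  have hn : (0 : ℝ) < n := by exact_mod_cast hn1
  have hεle : K / 2 / n ≤ ε₀ := by
    have h1 := Nat.ceil_le.1 hn2
    rw [div_le_iff₀ hε₀] at h1
    rw [div_le_iff₀ hn]
    linarith
  obtain ⟨F, W, hF1, hF2, hF3, hF4, hF5⟩ := hcells (K / 2 / n) (by positivity) hεle
  have hcard : 2 * n ≤ F.card := by
    have h1 : (2 * n : ℝ) ≤ F.card := by
      rw [div_div, mul_div_assoc', le_div_iff₀ (by positivity), mul_comm] at hF5
      exact le_of_mul_le_mul_right hF5 hK
    exact_mod_cast h1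
  have hval : n * (κ * (a * (K / 2 / n)) ^ (1 / θ)) = (b * (n : ℝ) ^ (-(1 / ξ1))) ^ r := by
    rw [← mul_div_assoc, Real.div_rpow (by positivity) hn.le, Real.mul_rpow hb.le (by positivity),
      ← hKb, ← Real.rpow_mul hn.le, hθinv, Real.rpow_add hn, Real.rpow_one,
      show -(1 / ξ1) * r = -(r / ξ1) by ring, Real.rpow_neg hn.le]
    field_simp
  have hbound : b * (n : ℝ) ^ (-(1 / ξ1)) ≤ quantErr μ n r := by
    refine le_csInf ⟨_, {0}, ⟨Finset.singleton_nonempty _, by simpa using hn1⟩, rfl⟩ ?_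
    rintro _ ⟨α, ⟨hα0, hα⟩, rfl⟩
    have h1 := ofReal_le_lintegral_infDist hr hs0 hfm hEi hνE (fun i => (ht i).le) hν hτ F
      (fun i => i.1 ++ i.2) W hF1 hF2 hF3 hF4 n hcard α hα0 hα
    have hcont : Continuous fun x : EuclideanSpace ℝ (Fin q) =>
        Metric.infDist x (α : Set (EuclideanSpace ℝ (Fin q))) ^ r :=
      (Metric.continuous_infDist_pt _).rpow_const fun _ => Or.inr hr.le
    have hint : Integrable (fun x : EuclideanSpace ℝ (Fin q) =>
        Metric.infDist x (α : Set (EuclideanSpace ℝ (Fin q))) ^ r) μ := by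
      obtain ⟨D, hD⟩ := (hKμ.image hcont).isBounded.exists_norm_le
      have hae : ∀ᵐ x ∂μ, x ∈ Kμ := hμK
      refine Integrable.of_bound hcont.aestronglyMeasurable D ?_
      filter_upwards [hae] with x hx
      exact hD _ ⟨x, hx, rfl⟩
    have hnn : ∀ x : EuclideanSpace ℝ (Fin q),
        0 ≤ Metric.infDist x (α : Set (EuclideanSpace ℝ (Fin q))) ^ r :=
      fun x => Real.rpow_nonneg Metric.infDist_nonneg r
    rw [← ofReal_integral_eq_lintegral_ofReal hint (Eventually.of_forall hnn),
      ENNReal.ofReal_le_ofReal_iff (integral_nonneg hnn), ← hκdef, hval] at h1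
    have h2 := Real.rpow_le_rpow (by positivity) h1 (one_div_pos.2 hr).le
    rwa [← Real.rpow_mul (by positivity), mul_one_div_cancel hr.ne', Real.rpow_one] at h2
  calc B ≤ b := hB
    _ = (n : ℝ) ^ (1 / ξ1) * (b * (n : ℝ) ^ (-(1 / ξ1))) := by
      rw [Real.rpow_neg hn.le]
      field_simp
    _ ≤ _ := by gcongr
end

section
/- For every n ≥ N + 1, writing m := ⌊n/(N+1)⌋, one has e_{n,r}(μ)^r ≤ p_0 e_{m,r}(ν)^r + Σ_{i=1}^N p_i s_i^r e_{m,r}(μ)^r. (No separation condition on (f_i)_{i=1}^N is needed.) -/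
open MeasureTheory Filter

section QuantizationError

variable {q : ℕ} {P : Measure (EuclideanSpace ℝ (Fin q))} {r : ℝ}

lemma continuous_infDist_rpow (hr : 0 ≤ r) (A : Set (EuclideanSpace ℝ (Fin q))) :
    Continuous fun x => Metric.infDist x A ^ r :=
  (Metric.continuous_infDist_pt A).rpow_const fun _ => Or.inr hr

lemma integrable_of_continuous_of_compact_support [IsFiniteMeasure P]
    (hP : ∃ K, IsCompact K ∧ P Kᶜ = 0) {g : EuclideanSpace ℝ (Fin q) → ℝ} (hg : Continuous g) :
    Integrable g P := by
  obtain ⟨K, hK, hK0⟩ := hP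
  have h := hg.continuousOn.integrableOn_compact (μ := P) hK
  rwa [IntegrableOn, Measure.restrict_eq_self_of_ae_mem] at h
  exact mem_ae_iff.mpr hK0

lemma integral_infDist_rpow_nonneg (P : Measure (EuclideanSpace ℝ (Fin q))) (r : ℝ)
    (A : Set (EuclideanSpace ℝ (Fin q))) : 0 ≤ ∫ x, Metric.infDist x A ^ r ∂P :=
  integral_nonneg fun _ => Real.rpow_nonneg Metric.infDist_nonneg _

lemma quantErr_nonneg (P : Measure (EuclideanSpace ℝ (Fin q))) (n : ℕ) (r : ℝ) :
    0 ≤ quantErr P n r := by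
  apply Real.sInf_nonneg
  rintro _ ⟨α, -, rfl⟩
  exact Real.rpow_nonneg (integral_infDist_rpow_nonneg P r _) _

lemma quantErr_rpow_le (hr : 0 < r) {n : ℕ} {α : Finset (EuclideanSpace ℝ (Fin q))}
    (hα : α.Nonempty) (hn : α.card ≤ n) :
    quantErr P n r ^ r ≤ ∫ x, Metric.infDist x (α : Set (EuclideanSpace ℝ (Fin q))) ^ r ∂P := by
  have h : quantErr P n r ≤
      (∫ x, Metric.infDist x (α : Set (EuclideanSpace ℝ (Fin q))) ^ r ∂P) ^ (1 / r) := by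
    refine csInf_le ⟨0, ?_⟩ ⟨α, ⟨hα, hn⟩, rfl⟩
    rintro _ ⟨β, -, rfl⟩
    exact Real.rpow_nonneg (integral_infDist_rpow_nonneg P r _) _
  rwa [one_div, Real.le_rpow_inv_iff_of_pos (quantErr_nonneg P n r)
    (integral_infDist_rpow_nonneg P r _) hr] at h

lemma le_quantErr_rpow (hr : 0 < r) {n : ℕ} (hn : 1 ≤ n) {c : ℝ}
    (h : ∀ α : Finset (EuclideanSpace ℝ (Fin q)), α.Nonempty → α.card ≤ n →
      c ≤ ∫ x, Metric.infDist x (α : Set (EuclideanSpace ℝ (Fin q))) ^ r ∂P) :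
    c ≤ quantErr P n r ^ r := by
  rcases le_total c 0 with hc | hc
  · exact hc.trans (Real.rpow_nonneg (quantErr_nonneg P n r) r)
  rw [← Real.rpow_inv_le_iff_of_pos hc (quantErr_nonneg P n r) hr]
  refine le_csInf ⟨_, {0}, ⟨Finset.singleton_nonempty _, by simpa using hn⟩, rfl⟩ ?_
  rintro _ ⟨α, ⟨hα, hαn⟩, rfl⟩
  simp only [one_div]
  exact Real.rpow_le_rpow hc (h α hα hαn) (inv_nonneg.mpr hr.le)

lemma infDist_image_le_mul {X : Type*} [PseudoMetricSpace X] {g : X → X} {c : ℝ}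
    (hg : ∀ x y, dist (g x) (g y) = c * dist x y) {A B : Set X} (hA : A.Finite)
    (hne : A.Nonempty) (hAB : g '' A ⊆ B) (x : X) :
    Metric.infDist (g x) B ≤ c * Metric.infDist x A := by
  obtain ⟨y, hy, hxy⟩ := hA.isCompact.exists_infDist_eq_dist hne x
  rw [hxy, ← hg]
  exact Metric.infDist_le_dist_of_mem (hAB (Set.mem_image_of_mem g hy))

/-- The union of a codebook for the condensation part with the images of a codebook for the
in-homogeneous measure gives a codebook for the in-homogeneous measure. -/
lemma integral_infDist_rpow_le {ι : Type*} [Fintype ι] (hr : 0 < r)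
    {f : ι → EuclideanSpace ℝ (Fin q) → EuclideanSpace ℝ (Fin q)} {s : ι → ℝ}
    (hs : ∀ i, 0 ≤ s i) (hf : ∀ i x y, dist (f i x) (f i y) = s i * dist x y)
    {ν μ : Measure (EuclideanSpace ℝ (Fin q))} [IsFiniteMeasure ν] [IsFiniteMeasure μ]
    (hνc : ∃ K, IsCompact K ∧ ν Kᶜ = 0) (hμc : ∃ K, IsCompact K ∧ μ Kᶜ = 0)
    {p0 : ℝ} {p : ι → ℝ} (hp0 : 0 ≤ p0) (hp : ∀ i, 0 ≤ p i)
    (hμss : μ = ENNReal.ofReal p0 • ν + ∑ i, ENNReal.ofReal (p i) • μ.map (f i))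
    {A B C : Set (EuclideanSpace ℝ (Fin q))} (hA : A.Nonempty) (hB : B.Finite)
    (hB' : B.Nonempty) (hAC : A ⊆ C) (hBC : ∀ i, f i '' B ⊆ C) :
    ∫ x, Metric.infDist x C ^ r ∂μ ≤ p0 * ∫ x, Metric.infDist x A ^ r ∂ν
      + ∑ i, p i * s i ^ r * ∫ x, Metric.infDist x B ^ r ∂μ := by
  have hfc (i : ι) : Continuous (f i) :=
    (LipschitzWith.of_dist_le_mul (K := ⟨s i, hs i⟩) fun x y => (hf i x y).le).continuous
  have hC := continuous_infDist_rpow hr.le C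
  have hν : Integrable (fun x => Metric.infDist x C ^ r) ν :=
    integrable_of_continuous_of_compact_support hνc hC
  have hμ (i : ι) : Integrable (fun x => Metric.infDist (f i x) C ^ r) μ :=
    integrable_of_continuous_of_compact_support hμc (hC.comp (hfc i))
  have hmap (i : ι) : Integrable (fun x => Metric.infDist x C ^ r) (μ.map (f i)) :=
    (integrable_map_measure hC.aestronglyMeasurable (hfc i).aemeasurable).mpr (hμ i)
  have hsmul (i : ι) : Integrable (fun x => Metric.infDist x C ^ r)
      (ENNReal.ofReal (p i) • μ.map (f i)) := (hmap i).smul_measure ENNReal.ofReal_ne_top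
  have hsplit : ∫ x, Metric.infDist x C ^ r ∂μ = p0 * ∫ x, Metric.infDist x C ^ r ∂ν
      + ∑ i, p i * ∫ x, Metric.infDist (f i x) C ^ r ∂μ := by
    conv_lhs => rw [hμss]
    rw [integral_add_measure (hν.smul_measure ENNReal.ofReal_ne_top)
      (integrable_finsetSum_measure.mpr fun i _ => hsmul i),
      integral_finsetSum_measure fun i _ => hsmul i, integral_smul_measure,
      ENNReal.toReal_ofReal hp0, smul_eq_mul]
    congr 1
    refine Finset.sum_congr rfl fun i _ => ?_
    rw [integral_smul_measure, ENNReal.toReal_ofReal (hp i), smul_eq_mul,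
      integral_map (hfc i).aemeasurable hC.aestronglyMeasurable]
  rw [hsplit]
  refine add_le_add (mul_le_mul_of_nonneg_left ?_ hp0) (Finset.sum_le_sum fun i _ => ?_)
  · exact integral_mono hν
      (integrable_of_continuous_of_compact_support hνc (continuous_infDist_rpow hr.le A))
      fun x => Real.rpow_le_rpow Metric.infDist_nonneg
        (Metric.infDist_le_infDist_of_subset hAC hA) hr.le
  · rw [mul_assoc, ← integral_const_mul (s i ^ r)]
    refine mul_le_mul_of_nonneg_left (integral_mono (hμ i)
      ((integrable_of_continuous_of_compact_support hμc
        (continuous_infDist_rpow hr.le B)).const_mul _) fun x => ?_) (hp i)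
    dsimp only
    rw [← Real.mul_rpow (hs i) Metric.infDist_nonneg]
    exact Real.rpow_le_rpow Metric.infDist_nonneg
      (infDist_image_le_mul (hf i) hB hB' (hBC i) x) hr.le

end QuantizationError

/-- Upper recursive bound for quantization errors of the in-homogeneous self-similar
measure: for `n ≥ N+1` and `m = ⌊n/(N+1)⌋`,
`e_{n,r}(μ)^r ≤ p_0 e_{m,r}(ν)^r + Σ_i p_i s_i^r e_{m,r}(μ)^r`. -/
theorem quantErr_upper_recursive_bound
    (q N : ℕ) (hq : 1 ≤ q) (hN : 2 ≤ N) (r : ℝ) (hr : 0 < r)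
    (f : Fin N → EuclideanSpace ℝ (Fin q) → EuclideanSpace ℝ (Fin q))
    (s : Fin N → ℝ) (hs : ∀ i, s i ∈ Set.Ioo (0 : ℝ) 1)
    (hf : ∀ i x y, dist (f i x) (f i y) = s i * dist x y)
    (t : Fin N → ℝ) (ht : ∀ i, 0 < t i) (ht1 : ∑ i, t i = 1)
    (ν : Measure (EuclideanSpace ℝ (Fin q))) (hνP : IsProbabilityMeasure ν)
    (hνc : ∃ K, IsCompact K ∧ ν Kᶜ = 0)
    (hνss : ν = ∑ i, ENNReal.ofReal (t i) • ν.map (f i))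
    (p0 : ℝ) (p : Fin N → ℝ) (hp0 : 0 < p0) (hp : ∀ i, 0 < p i)
    (hp1 : p0 + ∑ i, p i = 1)
    (μ : Measure (EuclideanSpace ℝ (Fin q))) (hμP : IsProbabilityMeasure μ)
    (hμc : ∃ K, IsCompact K ∧ μ Kᶜ = 0)
    (hμss : μ = ENNReal.ofReal p0 • ν + ∑ i, ENNReal.ofReal (p i) • μ.map (f i))
    :
    ∀ n : ℕ, N + 1 ≤ n →
      quantErr μ n r ^ r
        ≤ p0 * quantErr ν (n / (N + 1)) r ^ r
          + ∑ i, p i * s i ^ r * quantErr μ (n / (N + 1)) r ^ r := by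
  classical
  intro n hn
  set m := n / (N + 1) with hm
  have hm1 : 1 ≤ m := (Nat.one_le_div_iff (Nat.succ_pos N)).mpr hn
  have key (α β : Finset (EuclideanSpace ℝ (Fin q))) (hα : α.Nonempty) (hαm : α.card ≤ m)
      (hβ : β.Nonempty) (hβm : β.card ≤ m) :
      quantErr μ n r ^ r ≤
        p0 * ∫ x, Metric.infDist x (α : Set (EuclideanSpace ℝ (Fin q))) ^ r ∂ν
          + (∑ i, p i * s i ^ r) *
            ∫ x, Metric.infDist x (β : Set (EuclideanSpace ℝ (Fin q))) ^ r ∂μ := by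
    let γ := α ∪ Finset.univ.biUnion fun i => β.image (f i)
    have hγ : γ.card ≤ n := by
      have h : (Finset.univ.biUnion fun i => β.image (f i)).card ≤ N * m := by
        simpa using Finset.card_biUnion_le_card_mul Finset.univ (fun i => β.image (f i)) m
          fun i _ => Finset.card_image_le.trans hβm
      calc γ.card ≤ m + N * m := (Finset.card_union_le _ _).trans (add_le_add hαm h)
        _ = m * (N + 1) := by ring
        _ ≤ n := Nat.div_mul_le_self n (N + 1)
    refine (quantErr_rpow_le hr (hα.mono Finset.subset_union_left) hγ).trans ?_
    rw [Finset.sum_mul]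
    refine integral_infDist_rpow_le hr (fun i => (hs i).1.le) hf hνc hμc hp0.le
      (fun i => (hp i).le) hμss hα β.finite_toSet hβ
      (Finset.coe_subset.mpr Finset.subset_union_left) fun i => ?_
    rintro _ ⟨x, hx, rfl⟩
    exact Finset.mem_union_right _
      (Finset.mem_biUnion.mpr ⟨i, Finset.mem_univ i, Finset.mem_image_of_mem _ hx⟩)
  have : Nonempty (Fin N) := ⟨⟨0, by lia⟩⟩
  have hS : 0 < ∑ i, p i * s i ^ r :=
    Finset.sum_pos (fun i _ => mul_pos (hp i) (Real.rpow_pos_of_pos (hs i).1 r))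
      Finset.univ_nonempty
  rw [← Finset.sum_mul, ← sub_le_iff_le_add', ← div_le_iff₀' hS]
  refine le_quantErr_rpow hr hm1 fun β hβ hβm => ?_
  rw [div_le_iff₀' hS, sub_le_iff_le_add, ← sub_le_iff_le_add', ← div_le_iff₀' hp0]
  refine le_quantErr_rpow hr hm1 fun α hα hαm => ?_
  rw [div_le_iff₀' hp0, sub_le_iff_le_add']
  linarith [key α β hα hαm hβ hβm]
end
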